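/- Let κ > 41/83 be a real number. Then there exists a positive integer p₀ (depending only on κ) such that for every prime p ≥ p₀ and every multiplicative subgroup R ⊆ F_p* with |R| ≥ p^κ, every element of F_p* is a sum of six elements of R; that is, F_p* ⊆ 6R. -/

import Mathlib

open Finset Pointwise

/-- `R` is (the image in `F_p` of) a multiplicative subgroup of `F_p^*`. -/
def IsMulSubgroup (p : ℕ) (R : Finset (ZMod p)) : Prop :=
  ∃ H : Subgroup (ZMod p)ˣ, (R : Set (ZMod p)) = Units.val '' (H : Set (ZMod p)ˣ)

namespace SixR
open Polynomial

section stepanov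
variable {p : ℕ} [Fact p.Prime]

/-- A polynomial of degree `< p` with at most `n` terms does not vanish at `1` to order `n`. -/
lemma sparse_not_dvd (n : ℕ) : ∀ f : (ZMod p)[X], f ≠ 0 → f.natDegree < p →
    f.support.card ≤ n → ¬ (X - C 1) ^ n ∣ f := by
  induction n with
  | zero =>
    intro f hf _ hc _
    apply hf
    rw [← Polynomial.support_eq_empty, ← Finset.card_eq_zero]
    omega
  | succ n ih =>
    intro f hf hd hc hdvd
    obtain ⟨k, hk⟩ : f.support.Nonempty := by
      rwa [Finset.nonempty_iff_ne_empty, ne_eq, Polynomial.support_eq_empty]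
    have hkd : k ≤ f.natDegree := le_natDegree_of_mem_supp k hk
    set g : (ZMod p)[X] := X * derivative f - C (k : ZMod p) * f with hg
    have hcoeff : ∀ i, g.coeff i = ((i : ZMod p) - k) * f.coeff i := by
      intro i
      rw [hg, coeff_sub, coeff_C_mul]
      rcases i with _ | i
      · simp
      · rw [coeff_X_mul, coeff_derivative]; push_cast; ring
    have hsub : g.support ⊆ f.support.erase k := by
      intro i hi
      rw [mem_support_iff, hcoeff] at hi
      rw [Finset.mem_erase, mem_support_iff]
      refine ⟨?_, right_ne_zero_of_mul hi⟩
      rintro rfl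
      simp at hi
    have hgc : g.support.card ≤ n := by
      have := Finset.card_le_card hsub
      rw [Finset.card_erase_of_mem hk] at this
      omega
    have hgd : g.natDegree < p := by
      by_cases h0 : g = 0
      · rw [h0, natDegree_zero]; exact (Fact.out : p.Prime).pos
      · have := hsub (natDegree_mem_support_of_nonzero h0)
        have := le_natDegree_of_mem_supp _ (Finset.mem_of_mem_erase this)
        omega
    have hgdvd : (X - C 1) ^ n ∣ g := by
      obtain ⟨h, rfl⟩ := hdvd
      refine ⟨X * (((n + 1 : ℕ) : (ZMod p)[X]) * h + (X - C 1) * derivative h) - C (k : ZMod p) * ((X - C 1) * h), ?_⟩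
      rw [hg]
      simp only [derivative_mul, derivative_X_sub_C_pow]
      simp only [Nat.add_sub_cancel]
      push_cast
      simp only [map_add, map_natCast, map_one]
      ring
    by_cases h0 : g = 0
    · have hmon : f = C (f.coeff k) * X ^ k := by
        ext i
        rw [coeff_C_mul, coeff_X_pow]
        by_cases hik : i = k
        · simp [hik]
        · rw [if_neg hik, mul_zero]
          by_contra hne
          have h1 := hcoeff i
          rw [h0, coeff_zero] at h1
          have h2 : ((i : ZMod p) - k) = 0 := by
            rcases mul_eq_zero.mp h1.symm with h | h
            · exact h
            · exact absurd h hne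
          have hi : i < p := lt_of_le_of_lt (le_natDegree_of_ne_zero hne) hd
          have hk' : k < p := lt_of_le_of_lt hkd hd
          have h3 : (i : ZMod p) = k := sub_eq_zero.mp h2
          rw [ZMod.natCast_eq_natCast_iff', Nat.mod_eq_of_lt hi, Nat.mod_eq_of_lt hk'] at h3
          exact hik h3
      have h1 : (X - C 1) ∣ f := (dvd_pow_self _ (Nat.succ_ne_zero n)).trans hdvd
      rw [dvd_iff_isRoot, IsRoot.def, hmon] at h1
      simp at h1
      exact (mem_support_iff.mp hk) h1
    · exact ih g h0 hgd hgc hgdvd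

/-- The operator `X (1 - X) d/dX`. -/
noncomputable def dl (f : (ZMod p)[X]) : (ZMod p)[X] := X * (1 - X) * derivative f

lemma dl_sum {ι : Type*} (s : Finset ι) (f : ι → (ZMod p)[X]) :
    dl (∑ i ∈ s, f i) = ∑ i ∈ s, dl (f i) := by
  simp [dl, Finset.mul_sum]

lemma dl_C_mul (c : ZMod p) (f : (ZMod p)[X]) : dl (C c * f) = C c * dl f := by
  simp [dl]; ring

lemma dl_iter_sum {ι : Type*} (s : Finset ι) (f : ι → (ZMod p)[X]) (j : ℕ) :
    dl^[j] (∑ i ∈ s, f i) = ∑ i ∈ s, dl^[j] (f i) := by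
  induction j generalizing f with
  | zero => simp
  | succ j ih => simp only [Function.iterate_succ_apply]; rw [dl_sum, ih]

lemma dl_iter_C_mul (c : ZMod p) (f : (ZMod p)[X]) (j : ℕ) :
    dl^[j] (C c * f) = C c * dl^[j] f := by
  induction j generalizing f with
  | zero => simp
  | succ j ih => simp only [Function.iterate_succ_apply]; rw [dl_C_mul, ih]

/-- Twisted operator. -/
noncomputable def op (t b c : ℕ) (f : (ZMod p)[X]) : (ZMod p)[X] :=
  X * (1 - X) * derivative f + (((t * b : ℕ) : (ZMod p)[X]) * (1 - X) - ((t * c : ℕ) : (ZMod p)[X]) * X) * f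

lemma dl_mul_mon (t b c : ℕ) (f : (ZMod p)[X]) :
    dl (f * (X ^ (t * b) * (1 - X) ^ (t * c))) = op t b c f * (X ^ (t * b) * (1 - X) ^ (t * c)) := by
  have h1 : ∀ n : ℕ, X * derivative ((X : (ZMod p)[X]) ^ n) = (n : (ZMod p)[X]) * X ^ n := by
    intro n
    rcases n with _ | n
    · simp
    · rw [derivative_X_pow]; simp [pow_succ]; ring
  have h2 : ∀ n : ℕ, (1 - X) * derivative ((1 - X : (ZMod p)[X]) ^ n) = - ((n : (ZMod p)[X]) * (1 - X) ^ n) := by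
    intro n
    rcases n with _ | n
    · simp
    · rw [derivative_pow]; simp [pow_succ]; ring
  unfold dl op
  rw [derivative_mul, derivative_mul]
  linear_combination (1 - X) * f * (1 - X) ^ (t * c) * h1 (t * b) + X * f * X ^ (t * b) * h2 (t * c)

lemma dl_iter_mul_mon (t b c : ℕ) (f : (ZMod p)[X]) (j : ℕ) :
    dl^[j] (f * (X ^ (t * b) * (1 - X) ^ (t * c)))
      = (op t b c)^[j] f * (X ^ (t * b) * (1 - X) ^ (t * c)) := by
  induction j generalizing f with
  | zero => simp
  | succ j ih => simp only [Function.iterate_succ_apply]; rw [dl_mul_mon, ih]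

lemma natDegree_op (t b c : ℕ) (f : (ZMod p)[X]) :
    (op t b c f).natDegree ≤ f.natDegree + 1 := by
  unfold op
  have h1 : (1 - X : (ZMod p)[X]).natDegree ≤ 1 := by compute_degree
  refine natDegree_add_le_of_degree_le ?_ ?_
  · by_cases h : f.natDegree = 0
    · rw [natDegree_eq_zero] at h
      obtain ⟨a, rfl⟩ := h
      simp
    · refine (natDegree_mul_le).trans ?_
      have h3 := natDegree_derivative_lt h
      have : (X * (1 - X) : (ZMod p)[X]).natDegree ≤ 2 := by compute_degree
      omega
  · refine (natDegree_mul_le).trans ?_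
    have : (((t * b : ℕ) : (ZMod p)[X]) * (1 - X) - ((t * c : ℕ) : (ZMod p)[X]) * X).natDegree ≤ 1 := by
      compute_degree
    omega

lemma natDegree_op_iter (t b c : ℕ) (f : (ZMod p)[X]) (j : ℕ) :
    ((op t b c)^[j] f).natDegree ≤ f.natDegree + j := by
  induction j with
  | zero => simp
  | succ j ih =>
    rw [Function.iterate_succ_apply']
    exact (natDegree_op _ _ _ _).trans (by omega)

lemma eval_dl_iter (x : ZMod p) (k : ℕ) : ∀ g : (ZMod p)[X],
    eval x (dl^[k] ((X - C x) ^ k * g)) = (k.factorial : ZMod p) * (x * (1 - x)) ^ k * eval x g := by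
  induction k with
  | zero => intro g; simp
  | succ k ih =>
    intro g
    rw [Function.iterate_succ_apply]
    have : dl ((X - C x) ^ (k + 1) * g) = (X - C x) ^ k *
        (X * (1 - X) * (((k + 1 : ℕ) : (ZMod p)[X]) * g + (X - C x) * derivative g)) := by
      unfold dl
      simp only [derivative_mul, derivative_X_sub_C_pow]
      simp only [Nat.add_sub_cancel]
      push_cast
      simp only [map_add, map_natCast, map_one]
      ring
    rw [this, ih]
    simp [Nat.factorial_succ]
    ring

lemma pow_dvd_of_dl (x : ZMod p) (hx0 : x ≠ 0) (hx1 : x ≠ 1) (f : (ZMod p)[X]) (D : ℕ) (hD : D ≤ p)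
    (h : ∀ j < D, eval x (dl^[j] f) = 0) : (X - C x) ^ D ∣ f := by
  induction D with
  | zero => simp
  | succ D ih =>
    obtain ⟨g, hg⟩ := ih (by omega) (fun j hj => h j (by omega))
    have h1 := h D (by omega)
    rw [hg, eval_dl_iter] at h1
    have h2 : (D.factorial : ZMod p) ≠ 0 := by
      rw [ne_eq, ZMod.natCast_eq_zero_iff, (Fact.out : p.Prime).dvd_factorial]
      omega
    have h3 : (x * (1 - x)) ^ D ≠ 0 := pow_ne_zero _ (mul_ne_zero hx0 (sub_ne_zero.mpr hx1.symm))
    have h4 : eval x g = 0 := by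
      rcases mul_eq_zero.mp h1 with h | h
      · exact absurd h (mul_ne_zero h2 h3)
      · exact h
    obtain ⟨g', rfl⟩ := dvd_iff_isRoot.mpr h4
    exact ⟨g', by rw [hg]; ring⟩

/-- nonvanishing of the auxiliary polynomial -/
lemma aux_ne_zero (t A B : ℕ) (hA : A ≤ t) (hAB : A * B ≤ t) (htB : t * B ≤ p) (ht : 0 < t)
    (l : Fin A × Fin B × Fin B → ZMod p)
    (h : ∑ i : Fin A × Fin B × Fin B, C (l i) *
      (X ^ (i.1 : ℕ) * (X ^ (t * (i.2.1 : ℕ)) * (1 - X) ^ (t * (i.2.2 : ℕ)))) = 0) : l = 0 := by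
  set f : Fin B → (ZMod p)[X] := fun c =>
    ∑ ab : Fin A × Fin B, C (l (ab.1, ab.2, c)) * X ^ ((ab.1 : ℕ) + t * (ab.2 : ℕ)) with hf
  have hsum : ∑ c : Fin B, (1 - X) ^ (t * (c : ℕ)) * f c = 0 := by
    rw [← h, Fintype.sum_prod_type]
    simp only [Fintype.sum_prod_type, hf, Finset.mul_sum]
    rw [Finset.sum_comm]
    refine Finset.sum_congr rfl fun a _ => ?_
    rw [Finset.sum_comm]
    refine Finset.sum_congr rfl fun b _ => Finset.sum_congr rfl fun c _ => ?_
    ring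
  have hinj : ∀ ab ab' : Fin A × Fin B, (ab.1 : ℕ) + t * (ab.2 : ℕ) = (ab'.1 : ℕ) + t * (ab'.2 : ℕ) →
      ab = ab' := by
    rintro ⟨a, b⟩ ⟨a', b'⟩ hh
    simp only at hh
    have ha : (a : ℕ) < t := lt_of_lt_of_le a.2 hA
    have ha' : (a' : ℕ) < t := lt_of_lt_of_le a'.2 hA
    have h1 : (b : ℕ) = b' := by
      have := congrArg (· / t) hh
      simpa [Nat.add_mul_div_left _ _ ht, Nat.div_eq_of_lt ha, Nat.div_eq_of_lt ha'] using this
    have h2 : (a : ℕ) = a' := by rw [h1] at hh; omega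
    exact Prod.ext (Fin.ext h2) (Fin.ext h1)
  have hcoef : ∀ c (ab : Fin A × Fin B), (f c).coeff ((ab.1 : ℕ) + t * (ab.2 : ℕ)) = l (ab.1, ab.2, c) := by
    intro c ab
    rw [hf]
    simp only [finsetSum_coeff, coeff_C_mul, coeff_X_pow]
    rw [Finset.sum_eq_single ab]
    · simp
    · intro ab' _ hne
      rw [if_neg, mul_zero]
      intro hh
      exact hne (hinj _ _ hh.symm)
    · simp
  have hsupp : ∀ c, (f c).support ⊆ Finset.univ.image
      (fun ab : Fin A × Fin B => (ab.1 : ℕ) + t * (ab.2 : ℕ)) := by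
    intro c i hi
    rw [mem_support_iff] at hi
    by_contra hni
    apply hi
    rw [hf]
    simp only [finsetSum_coeff, coeff_C_mul, coeff_X_pow]
    refine Finset.sum_eq_zero fun ab _ => ?_
    rw [if_neg, mul_zero]
    rintro rfl
    exact hni (Finset.mem_image_of_mem _ (Finset.mem_univ _))
  have hzero : ∀ n (hn : n < B), f ⟨n, hn⟩ = 0 := by
    intro n
    induction n using Nat.strong_induction_on with
    | _ n ih =>
      intro hn
      by_contra hne
      have hcard : (f ⟨n, hn⟩).support.card ≤ t := by
        refine (Finset.card_le_card (hsupp _)).trans (Finset.card_image_le.trans ?_)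
        simpa using hAB
      have hdeg : (f ⟨n, hn⟩).natDegree < p := by
        have := hsupp _ (natDegree_mem_support_of_nonzero hne)
        obtain ⟨ab, -, hab⟩ := Finset.mem_image.mp this
        rw [← hab]
        have h1 : (ab.1 : ℕ) < t := lt_of_lt_of_le ab.1.2 hA
        have h2 : (ab.2 : ℕ) + 1 ≤ B := ab.2.2
        have h3 : t * ((ab.2 : ℕ) + 1) ≤ t * B := Nat.mul_le_mul_left _ h2
        rw [mul_add, mul_one] at h3
        omega
      refine sparse_not_dvd t _ hne hdeg hcard ?_
      have h1X : (1 - X : (ZMod p)[X]) ≠ 0 := by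
        intro h0
        have := congrArg (eval 0) h0
        simp at this
      have hd : (1 - X : (ZMod p)[X]) ^ (t * n) * (1 - X) ^ t ∣ (1 - X) ^ (t * n) * f ⟨n, hn⟩ := by
        rw [← Finset.add_sum_erase _ _ (Finset.mem_univ (⟨n, hn⟩ : Fin B))] at hsum
        rw [eq_neg_of_add_eq_zero_left hsum, dvd_neg]
        refine Finset.dvd_sum fun c hc => ?_
        rcases lt_trichotomy (c : ℕ) n with hlt | heq | hgt
        · rw [show f c = 0 from ih c hlt c.2, mul_zero]; exact dvd_zero _
        · exact absurd (Fin.ext heq) (Finset.ne_of_mem_erase hc)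
        · rw [← pow_add]
          refine Dvd.dvd.mul_right (pow_dvd_pow _ ?_) _
          have : t * (n + 1) ≤ t * c := Nat.mul_le_mul_left _ hgt
          rw [mul_add, mul_one] at this
          exact this
      have hd2 := (mul_dvd_mul_iff_left (pow_ne_zero _ h1X)).mp hd
      have e : (X - C 1 : (ZMod p)[X]) = -(1 - X) := by simp
      refine (pow_dvd_pow_of_dvd ?_ t).trans hd2
      rw [e]
      exact neg_dvd.mpr dvd_rfl
  funext ⟨a, b, c⟩
  rw [← hcoef c (a, b), hzero c c.2]
  simp

end stepanov
end SixR

namespace SixR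
open Polynomial

section stepanov
variable {p : ℕ} [Fact p.Prime]

lemma stepanov_raw (t D B : ℕ) (Cs : Finset (ZMod p × ZMod p)) (Xs : Finset (ZMod p))
    (hX : ∀ x ∈ Xs, x ≠ 0 ∧ x ≠ 1 ∧ (x ^ t, (1 - x) ^ t) ∈ Cs)
    (hD : 0 < D) (hB : 2 * Cs.card * D < B ^ 2) (hDB : D * B ≤ t) (htB : t * B ≤ p) :
    D * Xs.card ≤ 2 * t * B := by
  have hB0 : 0 < B := by
    rcases Nat.eq_zero_or_pos B with h | h
    · subst h; simp at hB
    · exact h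
  have hDt : D ≤ t := le_trans (Nat.le_mul_of_pos_right D hB0) hDB
  have ht : 0 < t := lt_of_lt_of_le hD hDt
  have htp : t ≤ p := le_trans (Nat.le_mul_of_pos_right t hB0) htB
  let I := Fin D × Fin B × Fin B
  let J := Cs × Fin D × Fin (D + D)
  let G : (I → ZMod p) → (ZMod p × ZMod p) → ℕ → (ZMod p)[X] := fun l c j =>
    ∑ i : I, C (l i * (c.1 ^ (i.2.1 : ℕ) * c.2 ^ (i.2.2 : ℕ))) * (op t i.2.1 i.2.2)^[j] (X ^ (i.1 : ℕ))
  let T : (I → ZMod p) →ₗ[ZMod p] (J → ZMod p) :=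
    { toFun := fun l k => (G l k.1 k.2.1).coeff k.2.2
      map_add' := by
        intro l l'
        funext k
        simp only [G, finsetSum_coeff, coeff_C_mul, Pi.add_apply, ← Finset.sum_add_distrib]
        exact Finset.sum_congr rfl fun i _ => by ring
      map_smul' := by
        intro a l
        funext k
        simp only [G, finsetSum_coeff, coeff_C_mul, Pi.smul_apply, smul_eq_mul, Finset.mul_sum,
          RingHom.id_apply]
        exact Finset.sum_congr rfl fun i _ => by ring }
  have hrank : Module.finrank (ZMod p) (J → ZMod p) < Module.finrank (ZMod p) (I → ZMod p) := by
    rw [Module.finrank_fintype_fun_eq_card, Module.finrank_fintype_fun_eq_card]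
    simp only [I, J, Fintype.card_prod, Fintype.card_fin, Fintype.card_coe]
    nlinarith
  obtain ⟨l, hl, hl0⟩ := (Submodule.ne_bot_iff _).mp (LinearMap.ker_ne_bot_of_finrank_lt hrank (f := T))
  have hG : ∀ c ∈ Cs, ∀ j < D, G l c j = 0 := by
    intro c hc j hj
    ext k
    rw [coeff_zero]
    by_cases hk : k < D + D
    · have := congrFun (LinearMap.mem_ker.mp hl) (⟨c, hc⟩, ⟨j, hj⟩, ⟨k, hk⟩)
      exact this
    · apply coeff_eq_zero_of_natDegree_lt
      refine lt_of_le_of_lt (natDegree_sum_le_of_forall_le (n := D + j) _ _ ?_) (by omega)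
      intro i _
      refine (natDegree_C_mul_le _ _).trans ((natDegree_op_iter _ _ _ _ _).trans ?_)
      rw [natDegree_X_pow]
      have := i.1.2
      omega
  set F : (ZMod p)[X] := ∑ i : I, C (l i) *
      (X ^ (i.1 : ℕ) * (X ^ (t * (i.2.1 : ℕ)) * (1 - X) ^ (t * (i.2.2 : ℕ)))) with hF
  have hF0 : F ≠ 0 := fun h => hl0 (aux_ne_zero t D B hDt hDB htB ht l h)
  have hdeg : F.natDegree ≤ 2 * t * B := by
    refine natDegree_sum_le_of_forall_le _ _ fun i _ => ?_
    refine (natDegree_C_mul_le _ _).trans (natDegree_mul_le.trans ?_)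
    have h1 : ((1 - X : (ZMod p)[X]) ^ (t * (i.2.2 : ℕ))).natDegree ≤ t * i.2.2 := by
      refine natDegree_pow_le.trans ?_
      have : (1 - X : (ZMod p)[X]).natDegree ≤ 1 := by compute_degree
      exact (Nat.mul_le_mul_left _ this).trans (by rw [mul_one])
    have h2 := natDegree_mul_le (p := (X : (ZMod p)[X]) ^ (t * (i.2.1 : ℕ))) (q := (1 - X) ^ (t * (i.2.2 : ℕ)))
    rw [natDegree_X_pow] at h2 ⊢
    have h3 : (i.1 : ℕ) < D := i.1.2
    have h4 : t * ((i.2.1 : ℕ) + 1) ≤ t * B := Nat.mul_le_mul_left _ i.2.1.2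
    have h5 : t * ((i.2.2 : ℕ) + 1) ≤ t * B := Nat.mul_le_mul_left _ i.2.2.2
    rw [mul_add, mul_one] at h4 h5
    rw [mul_assoc]
    omega
  have hdvd : ∀ x ∈ Xs, (X - C x) ^ D ∣ F := by
    intro x hx
    obtain ⟨hx0, hx1, hc⟩ := hX x hx
    refine pow_dvd_of_dl x hx0 hx1 F D (hDt.trans htp) fun j hj => ?_
    have h1 := congrArg (eval x) (hG _ hc j hj)
    rw [hF, dl_iter_sum, eval_finsetSum]
    simp only [G, eval_finsetSum, eval_zero] at h1
    rw [← h1]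
    refine Finset.sum_congr rfl fun i _ => ?_
    rw [dl_iter_C_mul, dl_iter_mul_mon]
    simp only [eval_mul, eval_C, eval_pow, eval_X, eval_sub, eval_one, pow_mul]
    ring
  have hprod : (∏ x ∈ Xs, (X - C x) ^ D) ∣ F := by
    refine Finset.prod_dvd_of_coprime ?_ hdvd
    intro x _ y _ hxy
    exact (pairwise_coprime_X_sub_C (Function.injective_id) hxy).pow
  have hle := natDegree_le_of_dvd hprod hF0
  rw [natDegree_prod _ _ (fun x _ => pow_ne_zero _ (X_sub_C_ne_zero x))] at hle
  simp only [natDegree_pow, natDegree_X_sub_C, mul_one, Finset.sum_const, smul_eq_mul] at hle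
  rw [mul_comm]
  exact hle.trans hdeg

/-- The Stepanov bound. -/
lemma stepanov (t m : ℕ) (Cs : Finset (ZMod p × ZMod p)) (Xs : Finset (ZMod p))
    (hX : ∀ x ∈ Xs, x ≠ 0 ∧ x ≠ 1 ∧ (x ^ t, (1 - x) ^ t) ∈ Cs)
    (hm : Cs.card ≤ m) (h1 : 32 * m ≤ t ^ 2) (h2 : 4 * t ^ 4 * m ≤ p ^ 3) :
    Xs.card ^ 3 ≤ 2 ^ 12 * (t * m) ^ 2 := by
  rcases Nat.eq_zero_or_pos m with hm0 | hmpos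
  · have : Xs = ∅ := by
      rw [Finset.eq_empty_iff_forall_notMem]
      intro x hx
      have := Finset.card_pos.mpr ⟨_, (hX x hx).2.2⟩
      omega
    simp [this]
  -- choose D
  obtain ⟨D, hD1, hD2, hD3⟩ : ∃ D : ℕ, 0 < D ∧ 32 * m * D ^ 3 ≤ t ^ 2 ∧ t ^ 2 < 32 * m * (D + 1) ^ 3 := by
    let P : ℕ → Prop := fun D => 32 * m * D ^ 3 ≤ t ^ 2
    have hb : ∀ D, P D → D ≤ t ^ 2 := by
      intro D hD
      have : D ≤ D ^ 3 := Nat.le_self_pow (by norm_num) D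
      have h3 : D ^ 3 ≤ 32 * m * D ^ 3 := Nat.le_mul_of_pos_left _ (by omega)
      exact this.trans (h3.trans hD)
    have hP1 : P 1 := by simpa [P] using h1
    classical
    refine ⟨Nat.findGreatest P (t ^ 2), ?_, ?_, ?_⟩
    · exact Nat.le_findGreatest (hb 1 hP1) hP1
    · exact Nat.findGreatest_spec (P := P) (hb 1 hP1) hP1
    · by_contra hcon
      push Not at hcon
      have := Nat.le_findGreatest (P := P) (hb _ hcon) hcon
      omega
  set B := Nat.sqrt (2 * m * D) + 1 with hB
  have hB1 : 2 * m * D < B ^ 2 := Nat.lt_succ_sqrt' _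
  have hB2 : B ^ 2 ≤ 8 * m * D := by
    have h : Nat.sqrt (2 * m * D) ^ 2 ≤ 2 * m * D := Nat.sqrt_le' _
    have h' : 1 ≤ Nat.sqrt (2 * m * D) := by
      rw [Nat.le_sqrt']
      have : 0 < m * D := Nat.mul_pos hmpos hD1
      nlinarith
    rw [hB]
    nlinarith
  have hDB : D * B ≤ t := by
    rw [← Nat.pow_le_pow_iff_left (n := 2) (by norm_num)]
    calc (D * B) ^ 2 = D ^ 2 * B ^ 2 := by ring
      _ ≤ D ^ 2 * (8 * m * D) := Nat.mul_le_mul_left _ hB2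
      _ ≤ 32 * m * D ^ 3 := by nlinarith [Nat.zero_le (m * D ^ 3)]
      _ ≤ t ^ 2 := hD2
  have htB : t * B ≤ p := by
    rw [← Nat.pow_le_pow_iff_left (n := 6) (by norm_num)]
    calc (t * B) ^ 6 = t ^ 6 * (B ^ 2) ^ 3 := by ring
      _ ≤ t ^ 6 * (8 * m * D) ^ 3 := by gcongr
      _ = 16 * m ^ 2 * t ^ 6 * (32 * m * D ^ 3) := by ring
      _ ≤ 16 * m ^ 2 * t ^ 6 * t ^ 2 := by gcongr
      _ = (4 * t ^ 4 * m) ^ 2 := by ring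
      _ ≤ (p ^ 3) ^ 2 := by gcongr
      _ = p ^ 6 := by ring
  have hmain := stepanov_raw t D B Cs Xs hX hD1
    (lt_of_le_of_lt (by gcongr) hB1) hDB htB
  -- conclude
  rw [← Nat.pow_le_pow_iff_left (n := 2) (by norm_num)]
  have hD4 : t ^ 2 ≤ 256 * m * D ^ 3 := by
    have : (D + 1) ^ 3 ≤ (2 * D) ^ 3 := by gcongr; omega
    nlinarith [Nat.mul_le_mul_left (32 * m) this]
  have h6 : D ^ 6 * Xs.card ^ 6 ≤ 2 ^ 15 * t ^ 6 * m ^ 3 * D ^ 3 := by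
    calc D ^ 6 * Xs.card ^ 6 = (D * Xs.card) ^ 6 := by ring
      _ ≤ (2 * t * B) ^ 6 := by gcongr
      _ = 2 ^ 6 * t ^ 6 * (B ^ 2) ^ 3 := by ring
      _ ≤ 2 ^ 6 * t ^ 6 * (8 * m * D) ^ 3 := by gcongr
      _ = 2 ^ 15 * t ^ 6 * m ^ 3 * D ^ 3 := by ring
  have hDp : 0 < D ^ 3 := by positivity
  have h7 : D ^ 3 * Xs.card ^ 6 ≤ 2 ^ 15 * t ^ 6 * m ^ 3 := by
    refine le_of_mul_le_mul_left (a := D ^ 3) ?_ hDp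
    calc D ^ 3 * (D ^ 3 * Xs.card ^ 6) = D ^ 6 * Xs.card ^ 6 := by ring
      _ ≤ _ := h6
      _ = _ := by ring
  have htpos : 0 < t ^ 2 := by omega
  refine le_of_mul_le_mul_left (a := t ^ 2) ?_ htpos
  calc t ^ 2 * (Xs.card ^ 3) ^ 2 ≤ (256 * m * D ^ 3) * (Xs.card ^ 3) ^ 2 := by gcongr
    _ = 256 * m * (D ^ 3 * Xs.card ^ 6) := by ring
    _ ≤ 256 * m * (2 ^ 15 * t ^ 6 * m ^ 3) := by gcongr
    _ = 2 ^ 23 * (t ^ 6 * m ^ 4) := by ring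
    _ ≤ 2 ^ 24 * (t ^ 6 * m ^ 4) := by gcongr; all_goals norm_num
    _ = t ^ 2 * (2 ^ 12 * (t * m) ^ 2) ^ 2 := by ring

end stepanov
end SixR

namespace SixR

section comb
variable {p : ℕ} [Fact p.Prime]

/-- number of points in a class -/
def npt (t : ℕ) (c : ZMod p × ZMod p) : ℕ :=
  #{y : ZMod p | y ≠ 0 ∧ y ≠ 1 ∧ (y ^ t, (1 - y) ^ t) = c}

lemma level (t τ : ℕ) (Cs : Finset (ZMod p × ZMod p)) (hpt : ∀ c ∈ Cs, τ ≤ npt t c)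
    (hτ : 64 ≤ τ) (hτ2 : 32 * t ^ 2 ≤ p * τ) (ht : 6 ≤ t) (htp : 4 * t ^ 4 ≤ p ^ 3) :
    Cs.card * τ ^ 3 ≤ 2 ^ 12 * t ^ 2 := by
  by_contra hcon
  push Not at hcon
  have hτpos : 0 < τ ^ 3 := by positivity
  set m := 2 ^ 12 * t ^ 2 / τ ^ 3 + 1 with hm
  have hm1 : 2 ^ 12 * t ^ 2 < m * τ ^ 3 := by
    rw [hm, mul_comm (_ + 1)]; exact Nat.lt_mul_div_succ _ hτpos
  have hm2 : m ≤ Cs.card := by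
    rw [hm, Nat.succ_le_iff, Nat.div_lt_iff_lt_mul hτpos]
    exact hcon
  have hτ3 : 2 ^ 18 ≤ τ ^ 3 := by
    calc 2 ^ 18 = 64 ^ 3 := by norm_num
      _ ≤ τ ^ 3 := by gcongr
  have hpτ : 2 ^ 15 * t ^ 6 ≤ p ^ 3 * τ ^ 3 := by
    calc 2 ^ 15 * t ^ 6 = (32 * t ^ 2) ^ 3 := by ring
      _ ≤ (p * τ) ^ 3 := by gcongr
      _ = _ := by ring
  have hc : 32 * m ≤ t ^ 2 ∧ 4 * t ^ 4 * m ≤ p ^ 3 := by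
    by_cases hs : τ ^ 3 ≤ 2 ^ 12 * t ^ 2
    · have h1 : m * τ ^ 3 ≤ 2 ^ 13 * t ^ 2 := by
        have := Nat.div_mul_le_self (2 ^ 12 * t ^ 2) (τ ^ 3)
        rw [hm, add_mul]; omega
      constructor
      · refine le_of_mul_le_mul_right (a := τ ^ 3) ?_ hτpos
        calc 32 * m * τ ^ 3 = 32 * (m * τ ^ 3) := by ring
          _ ≤ 32 * (2 ^ 13 * t ^ 2) := by gcongr
          _ = t ^ 2 * 2 ^ 18 := by ring
          _ ≤ _ := by gcongr
      · refine le_of_mul_le_mul_right (a := τ ^ 3) ?_ hτpos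
        calc 4 * t ^ 4 * m * τ ^ 3 = 4 * t ^ 4 * (m * τ ^ 3) := by ring
          _ ≤ 4 * t ^ 4 * (2 ^ 13 * t ^ 2) := by gcongr
          _ = 2 ^ 15 * t ^ 6 := by ring
          _ ≤ _ := hpτ
    · have : m = 1 := by rw [hm, Nat.div_eq_of_lt (by omega)]
      rw [this]
      constructor
      · nlinarith
      · simpa using htp
  obtain ⟨Cs', hsub, hcard⟩ := Finset.exists_subset_card_eq hm2
  set Xs : Finset (ZMod p) := {y | y ≠ 0 ∧ y ≠ 1 ∧ (y ^ t, (1 - y) ^ t) ∈ Cs'} with hXs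
  have hst := stepanov t m Cs' Xs (by intro x hx; simpa [hXs] using hx) hcard.le hc.1 hc.2
  have hlow : m * τ ≤ Xs.card := by
    rw [← hcard]
    have hmaps : ∀ x ∈ Xs, (x ^ t, (1 - x) ^ t) ∈ Cs' := by
      intro x hx; simp only [hXs, Finset.mem_filter] at hx; exact hx.2.2.2
    rw [Finset.card_eq_sum_card_fiberwise hmaps, ← smul_eq_mul]
    refine Finset.card_nsmul_le_sum _ _ _ fun c hc => (hpt c (hsub hc)).trans ?_
    unfold npt
    refine Finset.card_le_card fun y hy => ?_
    simp only [hXs, Finset.mem_filter, Finset.mem_univ, true_and] at hy ⊢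
    exact ⟨⟨hy.1, hy.2.1, hy.2.2 ▸ hc⟩, hy.2.2⟩
  have h3 : (m * τ) ^ 3 ≤ 2 ^ 12 * (t * m) ^ 2 := (by gcongr : (m * τ) ^ 3 ≤ Xs.card ^ 3).trans hst
  have hmpos : 0 < m ^ 2 := by positivity
  have : m ^ 2 * (m * τ ^ 3) ≤ m ^ 2 * (2 ^ 12 * t ^ 2) := by nlinarith
  have := le_of_mul_le_mul_left this hmpos
  omega

/-- dyadic pigeonhole -/
lemma dyadic {ι : Type*} (s : Finset ι) (f g : ι → ℕ) (L : ℕ) (hL : 0 < L) (h : ∀ x ∈ s, f x < 2 ^ L) :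
    ∃ j < L, ∑ x ∈ s, g x ≤ L * ∑ x ∈ s with Nat.log 2 (f x) = j, g x := by
  have hmaps : ∀ x ∈ s, Nat.log 2 (f x) ∈ Finset.range L := by
    intro x hx
    rw [Finset.mem_range]
    exact Nat.log_lt_of_lt_pow' hL.ne' (h x hx)
  obtain ⟨j, hj, hmax⟩ := Finset.exists_max_image (Finset.range L)
    (fun j => ∑ x ∈ s with Nat.log 2 (f x) = j, g x) ⟨0, by simpa using hL⟩
  refine ⟨j, Finset.mem_range.mp hj, ?_⟩
  rw [← Finset.sum_fiberwise_of_maps_to hmaps]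
  have := Finset.sum_le_card_nsmul _ _ _ hmax
  simpa using this

variable {R : Finset (ZMod p)} {t : ℕ}

/-- number of representations as a difference -/
def rep (R : Finset (ZMod p)) (x : ZMod p) : ℕ := #{ab ∈ R ×ˢ R | ab.1 - ab.2 = x}

/-- number of representations as a ratio -/
def rat (R : Finset (ZMod p)) (l : ZMod p) : ℕ := #{ab ∈ R ×ˢ R | ab.1 + 1 = l * (ab.2 + 1)}

lemma ne_zero_of_mem (hR : ∀ x, x ∈ R ↔ x ^ t = 1) (ht : 0 < t) {x : ZMod p} (hx : x ∈ R) : x ≠ 0 := by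
  rintro rfl
  rw [hR, zero_pow ht.ne'] at hx
  exact zero_ne_one hx

lemma rep_le (hR : ∀ x, x ∈ R ↔ x ^ t = 1) (ht : 0 < t) (x : ZMod p) (hx : x ≠ 0) :
    rep R x ≤ npt t ((x ^ t)⁻¹, (-1) ^ t * (x ^ t)⁻¹) := by
  unfold rep npt
  refine Finset.card_le_card_of_injOn (fun ab => ab.1 / x) ?_ ?_
  · rintro ⟨a, b⟩ hab
    simp only [Finset.coe_filter, Set.mem_ofPred_eq, Finset.mem_product, Finset.mem_univ, true_and] at hab ⊢
    obtain ⟨⟨ha, hb⟩, hx'⟩ := hab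
    have ha0 := ne_zero_of_mem hR ht ha
    have hb0 := ne_zero_of_mem hR ht hb
    have e1 : 1 - a / x = -1 * (b / x) := by field_simp; rw [← hx']; ring
    refine ⟨div_ne_zero ha0 hx, ?_, ?_⟩
    · intro h
      rw [h] at e1
      have : b / x = 0 := by linear_combination e1
      exact (div_ne_zero hb0 hx) this
    · rw [e1, mul_pow, div_pow, div_pow, (hR a).mp ha, (hR b).mp hb, one_div]
  · rintro ⟨a, b⟩ hab ⟨a', b'⟩ hab' h
    simp only [Finset.coe_filter, Set.mem_ofPred_eq, Finset.mem_product] at hab hab' h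
    have h1 : a = a' := by
      field_simp at h; exact h
    subst h1
    have : b = b' := by linear_combination hab'.2 - hab.2
    rw [this]

lemma rat_le (hR : ∀ x, x ∈ R ↔ x ^ t = 1) (ht : 0 < t) (l : ZMod p) (hl0 : l ≠ 0) (hl : l ≠ 1) :
    rat R l ≤ npt t (((l - 1) ^ t)⁻¹, (-1) ^ t * l ^ t * ((l - 1) ^ t)⁻¹) := by
  unfold rat npt
  have hl1 : l - 1 ≠ 0 := sub_ne_zero.mpr hl
  refine Finset.card_le_card_of_injOn (fun ab => ab.1 / (l - 1)) ?_ ?_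
  · rintro ⟨a, b⟩ hab
    simp only [Finset.coe_filter, Set.mem_ofPred_eq, Finset.mem_product, Finset.mem_univ, true_and] at hab ⊢
    obtain ⟨⟨ha, hb⟩, hx'⟩ := hab
    have ha0 := ne_zero_of_mem hR ht ha
    have hb0 := ne_zero_of_mem hR ht hb
    have e1 : 1 - a / (l - 1) = -1 * l * (b / (l - 1)) := by
      field_simp; linear_combination -hx'
    refine ⟨div_ne_zero ha0 hl1, ?_, ?_⟩
    · intro h
      rw [h] at e1
      have : l * (b / (l - 1)) = 0 := by linear_combination e1
      exact (mul_ne_zero hl0 (div_ne_zero hb0 hl1)) this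
    · rw [e1, mul_pow, mul_pow, div_pow, div_pow, (hR a).mp ha, (hR b).mp hb, one_div]
  · rintro ⟨a, b⟩ hab ⟨a', b'⟩ hab' h
    simp only [Finset.coe_filter, Set.mem_ofPred_eq, Finset.mem_product] at hab hab' h
    have h1 : a = a' := by
      field_simp at h; exact h
    subst h1
    have : l * b = l * b' := by linear_combination hab'.2 - hab.2
    rw [mul_left_cancel₀ hl0 this]

/-- few ratios with many representations -/
lemma rat_level (hR : ∀ x, x ∈ R ↔ x ^ t = 1) (τ : ℕ) (Ls : Finset (ZMod p))
    (hL : ∀ l ∈ Ls, l ≠ 0 ∧ l ≠ 1 ∧ τ ≤ rat R l)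
    (hτ : 64 ≤ τ) (hτ2 : 32 * t ^ 2 ≤ p * τ) (ht : 6 ≤ t) (htp : 4 * t ^ 4 ≤ p ^ 3) :
    Ls.card * τ ^ 2 ≤ 2 ^ 12 * t ^ 2 := by
  set Cs1 : Finset (ZMod p × ZMod p) :=
    Ls.image fun l => (((l - 1) ^ t)⁻¹, (-1) ^ t * l ^ t * ((l - 1) ^ t)⁻¹) with hCs1
  have h1 := level t τ Cs1 (by
    intro c hc
    obtain ⟨l, hl, rfl⟩ := Finset.mem_image.mp hc
    obtain ⟨h0, h1, h2⟩ := hL l hl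
    exact h2.trans (rat_le hR (by omega) l h0 h1)) hτ hτ2 ht htp
  set m := Cs1.card with hm
  set Cs2 : Finset (ZMod p × ZMod p) := Cs1.image fun c => ((-1) ^ t * c.2 * c.1⁻¹, (-1) ^ t * c.1⁻¹) with hCs2
  have hτpos : 0 < τ ^ 3 := by positivity
  have hτ3 : 2 ^ 18 ≤ τ ^ 3 := by
    calc 2 ^ 18 = 64 ^ 3 := by norm_num
      _ ≤ τ ^ 3 := by gcongr
  have hpτ : 2 ^ 15 * t ^ 6 ≤ p ^ 3 * τ ^ 3 := by
    calc 2 ^ 15 * t ^ 6 = (32 * t ^ 2) ^ 3 := by ring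
      _ ≤ (p * τ) ^ 3 := by gcongr
      _ = _ := by ring
  have hst := stepanov t m Cs2 Ls (by
    intro l hl
    obtain ⟨h0, h1, h2⟩ := hL l hl
    refine ⟨h0, h1, ?_⟩
    rw [hCs2, hCs1, Finset.image_image]
    refine Finset.mem_image.mpr ⟨l, hl, ?_⟩
    have hl1 : (l - 1) ^ t ≠ 0 := pow_ne_zero _ (sub_ne_zero.mpr h1)
    have hsq : ((-1 : ZMod p) ^ t) * (-1) ^ t = 1 := by rw [← mul_pow]; simp
    have e : (1 - l) ^ t = (-1) ^ t * (l - 1) ^ t := by rw [← mul_pow]; ring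
    simp only [Function.comp, inv_inv]
    refine Prod.ext ?_ ?_
    · simp only
      field_simp
      rw [← pow_mul, mul_comm t 2, pow_mul]; simp
    · simp only
      rw [e]) Finset.card_image_le
    (by
      refine le_of_mul_le_mul_right (a := τ ^ 3) ?_ hτpos
      calc 32 * m * τ ^ 3 = 32 * (m * τ ^ 3) := by ring
        _ ≤ 32 * (2 ^ 12 * t ^ 2) := by gcongr
        _ ≤ t ^ 2 * 2 ^ 18 := by omega
        _ ≤ _ := by gcongr)
    (by
      refine le_of_mul_le_mul_right (a := τ ^ 3) ?_ hτpos
      calc 4 * t ^ 4 * m * τ ^ 3 = 4 * t ^ 4 * (m * τ ^ 3) := by ring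
        _ ≤ 4 * t ^ 4 * (2 ^ 12 * t ^ 2) := by gcongr
        _ = 2 ^ 14 * t ^ 6 := by ring
        _ ≤ 2 ^ 15 * t ^ 6 := by gcongr; all_goals norm_num
        _ ≤ _ := hpτ)
  rw [← Nat.pow_le_pow_iff_left (n := 3) (by norm_num)]
  calc (Ls.card * τ ^ 2) ^ 3 = Ls.card ^ 3 * τ ^ 6 := by ring
    _ ≤ 2 ^ 12 * (t * m) ^ 2 * τ ^ 6 := by gcongr
    _ = 2 ^ 12 * t ^ 2 * (m * τ ^ 3) ^ 2 := by ring
    _ ≤ 2 ^ 12 * t ^ 2 * (2 ^ 12 * t ^ 2) ^ 2 := by gcongr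
    _ = _ := by ring

/-- many pairs give many distinct ratios -/
lemma distinct_ratios (hR : ∀ x, x ∈ R ↔ x ^ t = 1) (hcard : R.card = t) (H L : ℕ)
    (Is : Finset (ZMod p)) (Ps : Finset (ZMod p × ZMod p))
    (hI : ∀ l ∈ Is, l ≠ 0 ∧ l ≠ 1) (hP : Ps ⊆ R ×ˢ R)
    (hPI : ∀ ab ∈ Ps, ∃ l ∈ Is, ab.1 + 1 = l * (ab.2 + 1) ∧ ab.2 + 1 ≠ 0)
    (hL : t < 2 ^ L)
    (hH : 64 ≤ H) (hH2 : 32 * t ^ 2 ≤ p * H) (ht : 6 ≤ t) (htp : 4 * t ^ 4 ≤ p ^ 3) :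
    Ps.card ^ 2 ≤ 2 ^ 8 * H * L ^ 2 * t ^ 2 * Is.card := by
  have hL0 : 0 < L := by
    rcases Nat.eq_zero_or_pos L with h | h
    · subst h; simp at hL; omega
    · exact h
  have hrat : ∀ l ∈ Is, rat R l ≤ t := by
    intro l hl
    rw [← hcard]
    refine Finset.card_le_card_of_injOn (fun ab => ab.1) ?_ ?_
    · rintro ⟨a, b⟩ hab
      simp only [Finset.coe_filter, Set.mem_ofPred_eq, Finset.mem_product] at hab
      exact hab.1.1
    · rintro ⟨a, b⟩ hab ⟨a', b'⟩ hab' h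
      simp only [Finset.coe_filter, Set.mem_ofPred_eq, Finset.mem_product] at hab hab' h
      subst h
      have : l * b = l * b' := by linear_combination hab'.2 - hab.2
      rw [mul_left_cancel₀ (hI l hl).1 this]
  obtain ⟨j, hjL, hj⟩ := dyadic Is (rat R) (rat R) L hL0 (fun l hl => lt_of_le_of_lt (hrat l hl) hL)
  have hsum : Ps.card ≤ ∑ l ∈ Is, rat R l := by
    have hmaps : ∀ ab ∈ Ps, (ab.1 + 1) / (ab.2 + 1) ∈ Is := by
      intro ab hab
      obtain ⟨l, hl, h1, h2⟩ := hPI ab hab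
      rw [h1, mul_div_cancel_right₀ _ h2]; exact hl
    rw [Finset.card_eq_sum_card_fiberwise hmaps]
    refine Finset.sum_le_sum fun l hl => Finset.card_le_card fun ab hab => ?_
    simp only [Finset.mem_filter] at hab ⊢
    obtain ⟨l', hl', h1, h2⟩ := hPI ab hab.1
    refine ⟨hP hab.1, ?_⟩
    rw [← hab.2, div_mul_cancel₀ _ h2]
  set Ij := {l ∈ Is | Nat.log 2 (rat R l) = j} with hIj
  have hIjs : Ij.card ≤ Is.card := Finset.card_filter_le _ _
  have hub : ∑ l ∈ Ij, rat R l ≤ Ij.card * (2 * 2 ^ j) := by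
    rw [← smul_eq_mul]
    refine Finset.sum_le_card_nsmul _ _ _ fun l hl => ?_
    have := (Finset.mem_filter.mp hl).2
    rw [← this, ← pow_succ']
    exact (Nat.lt_pow_succ_log_self (by norm_num) _).le
  have hPs : Ps.card ≤ L * (Ij.card * (2 * 2 ^ j)) := hsum.trans (hj.trans (Nat.mul_le_mul_left _ hub))
  have hPst : Ps.card ≤ t ^ 2 := by
    refine (Finset.card_le_card hP).trans ?_
    rw [Finset.card_product, hcard, sq]
  by_cases hT : H ≤ 2 ^ j
  · have hlev := rat_level (t := t) hR (2 ^ j) Ij (by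
      intro l hl
      have h1 := (Finset.mem_filter.mp hl)
      refine ⟨(hI l h1.1).1, (hI l h1.1).2, ?_⟩
      rw [← h1.2]
      apply Nat.pow_log_le_self
      intro h0
      rw [h0, Nat.log_zero_right] at h1
      rw [← h1.2] at hT
      omega) (hH.trans hT) (hH2.trans (Nat.mul_le_mul_left _ hT)) ht htp
    calc Ps.card ^ 2 ≤ (L * (Ij.card * (2 * 2 ^ j))) ^ 2 := by gcongr
      _ = 4 * L ^ 2 * Ij.card * (Ij.card * (2 ^ j) ^ 2) := by ring
      _ ≤ 4 * L ^ 2 * Is.card * (2 ^ 12 * t ^ 2) := by gcongr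
      _ = 2 ^ 8 * 64 * L ^ 2 * t ^ 2 * Is.card := by ring
      _ ≤ _ := by gcongr
  · push Not at hT
    calc Ps.card ^ 2 = Ps.card * Ps.card := sq _
      _ ≤ (L * (Ij.card * (2 * 2 ^ j))) * t ^ 2 := by gcongr
      _ ≤ (L * (Is.card * (2 * H))) * t ^ 2 := by gcongr
      _ = 2 * H * L * t ^ 2 * Is.card := by ring
      _ ≤ 2 ^ 8 * H * L ^ 2 * t ^ 2 * Is.card := by
        gcongr
        · norm_num
        · exact Nat.le_self_pow (by norm_num) L

end comb
end SixR

namespace SixR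

section comb2
variable {p : ℕ} [Fact p.Prime]
variable {R : Finset (ZMod p)} {t : ℕ}

lemma one_mem (hR : ∀ x, x ∈ R ↔ x ^ t = 1) : (1 : ZMod p) ∈ R := by
  rw [hR, one_pow]

lemma mul_mem' (hR : ∀ x, x ∈ R ↔ x ^ t = 1) {a b : ZMod p} (ha : a ∈ R) (hb : b ∈ R) : a * b ∈ R := by
  rw [hR] at *
  rw [mul_pow, ha, hb, one_mul]

lemma inv_mem' (hR : ∀ x, x ∈ R ↔ x ^ t = 1) {a : ZMod p} (ha : a ∈ R) : a⁻¹ ∈ R := by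
  rw [hR] at *
  rw [inv_pow, ha, inv_one]

lemma card_le_mul_image (hR : ∀ x, x ∈ R ↔ x ^ t = 1) (hcard : R.card = t) (ht : 0 < t)
    (Q : Finset (ZMod p)) (h0 : ∀ x ∈ Q, x ≠ 0) :
    Q.card ≤ t * (Q.image (fun x => x ^ t)).card := by
  refine Finset.card_le_mul_card_image Q t ?_
  intro a ha
  obtain ⟨y, hy, rfl⟩ := Finset.mem_image.mp ha
  have hy0 := h0 y hy
  conv_rhs => rw [← hcard]
  refine Finset.card_le_card_of_injOn (fun x => x / y) ?_ ?_
  · intro x hx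
    simp only [Finset.coe_filter, Set.mem_ofPred_eq] at hx
    change x / y ∈ R
    rw [hR, div_pow, hx.2, div_self (pow_ne_zero _ hy0)]
  · intro x hx x' hx' h
    simp only at h
    field_simp at h; exact h

lemma mul_image_le_card (hR : ∀ x, x ∈ R ↔ x ^ t = 1) (hcard : R.card = t)
    (Q : Finset (ZMod p)) (h0 : ∀ x ∈ Q, x ≠ 0) (hinv : ∀ x ∈ Q, ∀ a ∈ R, a * x ∈ Q) :
    t * (Q.image (fun x => x ^ t)).card ≤ Q.card := by
  refine Finset.mul_card_image_le_card Q t ?_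
  intro a ha
  obtain ⟨y, hy, rfl⟩ := Finset.mem_image.mp ha
  have hy0 := h0 y hy
  conv_lhs => rw [← hcard]
  refine Finset.card_le_card_of_injOn (fun a => a * y) ?_ ?_
  · intro a ha
    simp only [Finset.coe_filter, Set.mem_ofPred_eq]
    refine ⟨hinv y hy a ha, ?_⟩
    rw [mul_pow, (hR a).mp ha, one_mul]
  · intro x hx x' hx' h
    exact mul_right_cancel₀ hy0 h

lemma rep_level (hR : ∀ x, x ∈ R ↔ x ^ t = 1) (hcard : R.card = t) (τ : ℕ) (Q : Finset (ZMod p))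
    (h0 : ∀ x ∈ Q, x ≠ 0) (hQ : ∀ x ∈ Q, τ ≤ rep R x)
    (hτ : 64 ≤ τ) (hτ2 : 32 * t ^ 2 ≤ p * τ) (ht : 6 ≤ t) (htp : 4 * t ^ 4 ≤ p ^ 3) :
    τ ^ 3 * Q.card ≤ 2 ^ 12 * t ^ 3 := by
  have h1 := card_le_mul_image hR hcard (by omega) Q h0
  set It := Q.image (fun x => x ^ t) with hIt
  have h2 := level t τ (It.image fun y => (y⁻¹, (-1) ^ t * y⁻¹)) (by
    intro c hc
    obtain ⟨y, hy, rfl⟩ := Finset.mem_image.mp hc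
    obtain ⟨x, hx, rfl⟩ := Finset.mem_image.mp hy
    exact (hQ x hx).trans (rep_le hR (by omega) x (h0 x hx))) hτ hτ2 ht htp
  rw [Finset.card_image_of_injective _ (by
    intro y y' h
    simp only [Prod.mk.injEq] at h
    exact inv_injective h.1)] at h2
  calc τ ^ 3 * Q.card ≤ τ ^ 3 * (t * It.card) := by gcongr
    _ = t * (It.card * τ ^ 3) := by ring
    _ ≤ t * (2 ^ 12 * t ^ 2) := by gcongr
    _ = _ := by ring

lemma sum_rep_eq (R Q : Finset (ZMod p)) :
    ∑ x ∈ Q, rep R x = #{ab ∈ R ×ˢ R | ab.1 - ab.2 ∈ Q} := by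
  rw [Finset.card_eq_sum_card_fiberwise (f := fun ab => ab.1 - ab.2) (t := Q)]
  · refine Finset.sum_congr rfl fun x hx => ?_
    unfold rep
    congr 1
    ext ab
    simp only [Finset.mem_filter]
    constructor
    · rintro ⟨h1, h2⟩; exact ⟨⟨h1, h2 ▸ hx⟩, h2⟩
    · rintro ⟨⟨h1, _⟩, h2⟩; exact ⟨h1, h2⟩
  · intro ab hab
    simp only [Finset.coe_filter, Set.mem_ofPred_eq] at hab
    exact hab.2

lemma katz_koester (hR : ∀ x, x ∈ R ↔ x ^ t = 1) (hcard : R.card = t) (H L τ : ℕ)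
    (Q : Finset (ZMod p)) (h0 : ∀ x ∈ Q, x ≠ 0) (hinv : ∀ x ∈ Q, ∀ a ∈ R, a * x ∈ Q)
    (hQ : ∀ x ∈ Q, τ ≤ rep R x) (hτQ : 4 * t ≤ τ * Q.card)
    (c1 : 32 * (R + R).card ^ 2 * Q.card ≤ t ^ 5) (c2 : 4 * t * (R + R).card ^ 2 * Q.card ≤ p ^ 3)
    (hL : t < 2 ^ L)
    (hH : 64 ≤ H) (hH2 : 32 * t ^ 2 ≤ p * H) (ht : 6 ≤ t) (htp : 4 * t ^ 4 ≤ p ^ 3) :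
    τ ^ 6 * Q.card ^ 4 ≤ 2 ^ 42 * H ^ 3 * L ^ 6 * t ^ 2 * (R + R).card ^ 4 := by
  set S := (R + R).erase 0 with hS
  have hScard : S.card ≤ (R + R).card := Finset.card_erase_le
  set s := (R + R).card with hs
  set Ps : Finset (ZMod p × ZMod p) :=
    {ab ∈ R ×ˢ R | ab.1 - ab.2 ∈ Q ∧ ab.1 + 1 ≠ 0 ∧ ab.2 + 1 ≠ 0} with hPs
  set Is : Finset (ZMod p) := Ps.image fun ab => (ab.1 + 1) / (ab.2 + 1) with hIs
  set St := S.image (fun x => x ^ t) with hSt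
  set Qt := Q.image (fun x => x ^ t) with hQt
  have hStc : t * St.card ≤ s := by
    refine (mul_image_le_card hR hcard S ?_ ?_).trans hScard
    · intro x hx; exact (Finset.mem_erase.mp hx).1
    · intro x hx a ha
      obtain ⟨hx0, hx⟩ := Finset.mem_erase.mp hx
      obtain ⟨b, hb, c, hc, rfl⟩ := Finset.mem_add.mp hx
      refine Finset.mem_erase.mpr ⟨mul_ne_zero (ne_zero_of_mem hR (by omega) ha) hx0, ?_⟩
      rw [mul_add]
      exact Finset.add_mem_add (mul_mem' hR ha hb) (mul_mem' hR ha hc)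
  have hQtc : t * Qt.card ≤ Q.card := mul_image_le_card hR hcard Q h0 hinv
  set m := St.card * St.card * Qt.card with hm
  have hmS : t ^ 3 * m ≤ s ^ 2 * Q.card := by
    calc t ^ 3 * m = (t * St.card) ^ 2 * (t * Qt.card) := by rw [hm]; ring
      _ ≤ _ := by gcongr
  set Cs : Finset (ZMod p × ZMod p) := ((St ×ˢ St) ×ˢ Qt).image
    fun c => (c.1.1 * c.1.2⁻¹, (-1) ^ t * c.2 * c.1.2⁻¹) with hCs
  have hCsc : Cs.card ≤ m := by
    refine Finset.card_image_le.trans ?_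
    rw [Finset.card_product, Finset.card_product]
  have hInz : ∀ l ∈ Is, l ≠ 0 ∧ l ≠ 1 := by
    intro l hl
    obtain ⟨⟨a, b⟩, hab, rfl⟩ := Finset.mem_image.mp hl
    simp only [hPs, Finset.mem_filter, Finset.mem_product] at hab
    obtain ⟨⟨ha, hb⟩, hq, ha1, hb1⟩ := hab
    refine ⟨div_ne_zero ha1 hb1, ?_⟩
    intro h
    rw [div_eq_one_iff_eq hb1] at h
    apply h0 _ hq
    linear_combination h
  have tpos : 0 < t := by omega
  have hst := stepanov t m Cs Is (by
    intro l hl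
    refine ⟨(hInz l hl).1, (hInz l hl).2, ?_⟩
    obtain ⟨⟨a, b⟩, hab, rfl⟩ := Finset.mem_image.mp hl
    simp only [hPs, Finset.mem_filter, Finset.mem_product] at hab
    obtain ⟨⟨ha, hb⟩, hq, ha1, hb1⟩ := hab
    refine Finset.mem_image.mpr ⟨(((a + 1) ^ t, (b + 1) ^ t), (a - b) ^ t), ?_, ?_⟩
    · refine Finset.mem_product.mpr ⟨Finset.mem_product.mpr ⟨?_, ?_⟩, ?_⟩
      · exact Finset.mem_image_of_mem _ (Finset.mem_erase.mpr ⟨ha1, Finset.add_mem_add ha (one_mem hR)⟩)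
      · exact Finset.mem_image_of_mem _ (Finset.mem_erase.mpr ⟨hb1, Finset.add_mem_add hb (one_mem hR)⟩)
      · exact Finset.mem_image_of_mem (fun x => x ^ t) hq
    · have e : 1 - (a + 1) / (b + 1) = -1 * (a - b) * (b + 1)⁻¹ := by field_simp; ring
      simp only
      rw [e, mul_pow, mul_pow, div_pow, inv_pow, div_eq_mul_inv]) hCsc
    (by
      refine le_of_mul_le_mul_left (a := t ^ 3) ?_ (by positivity)
      calc t ^ 3 * (32 * m) = 32 * (t ^ 3 * m) := by ring
        _ ≤ 32 * (s ^ 2 * Q.card) := by gcongr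
        _ = 32 * s ^ 2 * Q.card := by ring
        _ ≤ t ^ 5 := c1
        _ = _ := by ring)
    (by
      calc 4 * t ^ 4 * m = 4 * t * (t ^ 3 * m) := by ring
        _ ≤ 4 * t * (s ^ 2 * Q.card) := by gcongr
        _ = 4 * t * s ^ 2 * Q.card := by ring
        _ ≤ _ := c2)
  have hdr := distinct_ratios hR hcard H L Is Ps hInz (Finset.filter_subset _ _) (by
    intro ab hab
    refine ⟨_, Finset.mem_image_of_mem _ hab, ?_⟩
    simp only [hPs, Finset.mem_filter, Finset.mem_product] at hab
    refine ⟨?_, hab.2.2.2⟩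
    rw [div_mul_cancel₀ _ hab.2.2.2]) hL hH hH2 ht htp
  have hPlow : τ * Q.card ≤ 2 * Ps.card := by
    have h1 : τ * Q.card ≤ ∑ x ∈ Q, rep R x := by
      rw [mul_comm, ← smul_eq_mul]
      exact Finset.card_nsmul_le_sum _ _ _ hQ
    rw [sum_rep_eq] at h1
    have h2 : #{ab ∈ R ×ˢ R | ab.1 - ab.2 ∈ Q} ≤ (Ps ∪ ({-1} ×ˢ R ∪ R ×ˢ {-1})).card := by
      refine Finset.card_le_card ?_
      rintro ⟨a, b⟩ hab
      simp only [Finset.mem_filter, Finset.mem_product] at hab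
      simp only [hPs, Finset.mem_union, Finset.mem_filter, Finset.mem_product, Finset.mem_singleton]
      by_cases ha : a = -1
      · right; left; exact ⟨ha, hab.1.2⟩
      by_cases hb : b = -1
      · right; right; exact ⟨hab.1.1, hb⟩
      left
      exact ⟨hab.1, hab.2, fun h => ha (eq_neg_of_add_eq_zero_left h), fun h => hb (eq_neg_of_add_eq_zero_left h)⟩
    have h3 : (Ps ∪ ({-1} ×ˢ R ∪ R ×ˢ {-1})).card ≤ Ps.card + (t + t) := by
      refine (Finset.card_union_le _ _).trans ?_
      gcongr
      refine (Finset.card_union_le _ _).trans ?_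
      simp [hcard]
    omega
  have hQpos : 0 < Q.card := by
    rcases Nat.eq_zero_or_pos Q.card with h | h
    · rw [h] at hτQ; omega
    · exact h
  have hI : t ^ 4 * Is.card ^ 3 ≤ 2 ^ 12 * s ^ 4 * Q.card ^ 2 := by
    calc t ^ 4 * Is.card ^ 3 ≤ t ^ 4 * (2 ^ 12 * (t * m) ^ 2) := by gcongr
      _ = 2 ^ 12 * (t ^ 3 * m) ^ 2 := by ring
      _ ≤ 2 ^ 12 * (s ^ 2 * Q.card) ^ 2 := by gcongr
      _ = _ := by ring
  have hA : (τ * Q.card) ^ 2 ≤ 2 ^ 10 * H * L ^ 2 * t ^ 2 * Is.card := by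
    calc (τ * Q.card) ^ 2 ≤ (2 * Ps.card) ^ 2 := by gcongr
      _ = 4 * Ps.card ^ 2 := by ring
      _ ≤ 4 * (2 ^ 8 * H * L ^ 2 * t ^ 2 * Is.card) := by gcongr
      _ = _ := by ring
  refine le_of_mul_le_mul_left (a := Q.card ^ 2) ?_ (by positivity)
  calc Q.card ^ 2 * (τ ^ 6 * Q.card ^ 4) = ((τ * Q.card) ^ 2) ^ 3 := by ring
    _ ≤ (2 ^ 10 * H * L ^ 2 * t ^ 2 * Is.card) ^ 3 := by gcongr
    _ = 2 ^ 30 * H ^ 3 * L ^ 6 * t ^ 2 * (t ^ 4 * Is.card ^ 3) := by ring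
    _ ≤ 2 ^ 30 * H ^ 3 * L ^ 6 * t ^ 2 * (2 ^ 12 * s ^ 4 * Q.card ^ 2) := by gcongr
    _ = _ := by ring

/-- additive energy -/
def nrg (R : Finset (ZMod p)) : ℕ := ∑ x : ZMod p, rep R x ^ 2

lemma rep_le_card (R : Finset (ZMod p)) (x : ZMod p) : rep R x ≤ R.card := by
  unfold rep
  refine Finset.card_le_card_of_injOn (fun ab => ab.1) ?_ ?_
  · rintro ⟨a, b⟩ hab
    simp only [Finset.coe_filter, Set.mem_ofPred_eq, Finset.mem_product] at hab
    exact hab.1.1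
  · rintro ⟨a, b⟩ hab ⟨a', b'⟩ hab' h
    simp only [Finset.coe_filter, Set.mem_ofPred_eq, Finset.mem_product] at hab hab' h
    subst h
    have : b = b' := by linear_combination hab'.2 - hab.2
    rw [this]

lemma rep_smul (hR : ∀ x, x ∈ R ↔ x ^ t = 1) (ht : 0 < t) (x a : ZMod p) (ha : a ∈ R) :
    rep R x ≤ rep R (a * x) := by
  have ha0 := ne_zero_of_mem hR ht ha
  unfold rep
  refine Finset.card_le_card_of_injOn (fun ab => (a * ab.1, a * ab.2)) ?_ ?_
  · rintro ⟨b, c⟩ hab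
    simp only [Finset.coe_filter, Set.mem_ofPred_eq, Finset.mem_product] at hab ⊢
    refine ⟨⟨mul_mem' hR ha hab.1.1, mul_mem' hR ha hab.1.2⟩, ?_⟩
    rw [← hab.2]; ring
  · rintro ⟨b, c⟩ _ ⟨b', c'⟩ _ h
    simp only [Prod.mk.injEq] at h
    rw [mul_left_cancel₀ ha0 h.1, mul_left_cancel₀ ha0 h.2]

lemma rep_smul_eq (hR : ∀ x, x ∈ R ↔ x ^ t = 1) (ht : 0 < t) (x a : ZMod p) (ha : a ∈ R) :
    rep R (a * x) = rep R x := by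
  refine le_antisymm ?_ (rep_smul hR ht x a ha)
  have := rep_smul hR ht (a * x) a⁻¹ (inv_mem' hR ha)
  rwa [inv_mul_cancel_left₀ (ne_zero_of_mem hR ht ha)] at this

lemma sum_rep (R : Finset (ZMod p)) : ∑ x : ZMod p, rep R x = R.card ^ 2 := by
  rw [sum_rep_eq]
  simp [sq]

/-- energy as a count -/
lemma nrg_eq (R : Finset (ZMod p)) :
    nrg R = #{q ∈ (R ×ˢ R) ×ˢ (R ×ˢ R) | q.1.1 - q.1.2 = q.2.1 - q.2.2} := by
  unfold nrg
  rw [Finset.card_eq_sum_card_fiberwise (f := fun q => q.1.1 - q.1.2) (t := univ) (by simp)]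
  refine Finset.sum_congr rfl fun x _ => ?_
  rw [sq]
  unfold rep
  rw [← Finset.card_product]
  congr 1
  ext ⟨⟨a, b⟩, ⟨c, d⟩⟩
  simp only [Finset.mem_filter, Finset.mem_product]
  constructor
  · rintro ⟨⟨h1, h2⟩, h3, h4⟩; exact ⟨⟨⟨h1, h3⟩, by rw [h2, h4]⟩, h2⟩
  · rintro ⟨⟨⟨h1, h3⟩, h4⟩, h2⟩; exact ⟨⟨h1, h2⟩, h3, by rw [← h4, h2]⟩

lemma cauchy_nrg (R : Finset (ZMod p)) : R.card ^ 4 ≤ (R + R).card * nrg R := by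
  set f : ZMod p → ℕ := fun x => #{ab ∈ R ×ˢ R | ab.1 + ab.2 = x} with hf
  have h1 : ∑ x ∈ R + R, f x = R.card ^ 2 := by
    rw [sq, ← Finset.card_product, Finset.card_eq_sum_card_fiberwise (f := fun ab => ab.1 + ab.2) (t := R + R)]
    rintro ⟨a, b⟩ hab
    simp only [Finset.coe_product, Set.mem_prod, Finset.mem_coe] at hab
    exact Finset.mem_coe.mpr (Finset.add_mem_add hab.1 hab.2)
  have h2 : ∑ x ∈ R + R, f x ^ 2 ≤ nrg R := by
    have : ∑ x ∈ R + R, f x ^ 2 ≤ ∑ x, f x ^ 2 :=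
      Finset.sum_le_sum_of_subset (Finset.subset_univ _)
    refine this.trans ?_
    rw [nrg_eq]
    have e : ∑ x, f x ^ 2 = #{q ∈ (R ×ˢ R) ×ˢ (R ×ˢ R) | q.1.1 + q.1.2 = q.2.1 + q.2.2} := by
      rw [Finset.card_eq_sum_card_fiberwise (f := fun q => q.1.1 + q.1.2) (t := univ) (by simp)]
      refine Finset.sum_congr rfl fun x _ => ?_
      rw [sq]
      simp only [hf]
      rw [← Finset.card_product]
      congr 1
      ext ⟨⟨a, b⟩, ⟨c, d⟩⟩
      simp only [Finset.mem_filter, Finset.mem_product]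
      constructor
      · rintro ⟨⟨h1, h2⟩, h3, h4⟩; exact ⟨⟨⟨h1, h3⟩, by rw [h2, h4]⟩, h2⟩
      · rintro ⟨⟨⟨h1, h3⟩, h4⟩, h2⟩; exact ⟨⟨h1, h2⟩, h3, by rw [← h4, h2]⟩
    rw [e]
    refine Finset.card_le_card_of_injOn (fun q => ((q.1.1, q.2.1), (q.2.2, q.1.2))) ?_ ?_
    · rintro ⟨⟨a, b⟩, ⟨c, d⟩⟩ h
      simp only [Finset.coe_filter, Set.mem_ofPred_eq, Finset.mem_product] at h ⊢
      exact ⟨⟨⟨h.1.1.1, h.1.2.1⟩, h.1.2.2, h.1.1.2⟩, by linear_combination h.2⟩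
    · rintro ⟨⟨a, b⟩, ⟨c, d⟩⟩ _ ⟨⟨a', b'⟩, ⟨c', d'⟩⟩ _ h
      simp only [Prod.mk.injEq] at h ⊢
      tauto
  calc R.card ^ 4 = (∑ x ∈ R + R, f x) ^ 2 := by rw [h1]; ring
    _ ≤ (R + R).card * ∑ x ∈ R + R, f x ^ 2 := sq_sum_le_card_mul_sum_sq
    _ ≤ _ := by gcongr

/-- dyadic level set of the representation function -/
lemma exists_level (hR : ∀ x, x ∈ R ↔ x ^ t = 1) (hcard : R.card = t) (ht : 0 < t) (L : ℕ)
    (hL : t < 2 ^ L) (hE : 2 * t ^ 2 ≤ nrg R) :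
    ∃ (τ : ℕ) (Q : Finset (ZMod p)), 0 < τ ∧ τ ≤ t ∧ (∀ x ∈ Q, x ≠ 0) ∧ (∀ x ∈ Q, ∀ a ∈ R, a * x ∈ Q) ∧
      (∀ x ∈ Q, τ ≤ rep R x) ∧ τ * Q.card ≤ t ^ 2 ∧ nrg R ≤ 8 * L * (τ ^ 2 * Q.card) := by
  have hL0 : 0 < L := by
    rcases Nat.eq_zero_or_pos L with h | h
    · subst h; simp at hL; omega
    · exact h
  set s : Finset (ZMod p) := {x | x ≠ 0 ∧ 0 < rep R x} with hs
  obtain ⟨j, hjL, hj⟩ := dyadic s (rep R) (fun x => rep R x ^ 2) L hL0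
    (fun x _ => lt_of_le_of_lt (rep_le_card R x) (hcard ▸ hL))
  set Q := {x ∈ s | Nat.log 2 (rep R x) = j} with hQ
  have hQs : ∀ x ∈ Q, x ≠ 0 ∧ 0 < rep R x ∧ Nat.log 2 (rep R x) = j := by
    intro x hx
    simp only [hQ, hs, Finset.mem_filter, Finset.mem_univ, true_and] at hx
    tauto
  have hlow : ∀ x ∈ Q, 2 ^ j ≤ rep R x := by
    intro x hx
    obtain ⟨_, h2, h3⟩ := hQs x hx
    rw [← h3]; exact Nat.pow_log_le_self _ h2.ne'
  have hE2 : nrg R ≤ t ^ 2 + ∑ x ∈ s, rep R x ^ 2 := by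
    have h1 : rep R 0 ^ 2 ≤ t ^ 2 := by
      have := rep_le_card R 0
      rw [hcard] at this
      gcongr
    have h2 : nrg R ≤ ∑ x ∈ insert 0 s, rep R x ^ 2 := by
      unfold nrg
      refine le_of_eq (Finset.sum_subset (Finset.subset_univ _) ?_).symm
      intro x _ hx
      simp only [hs, Finset.mem_insert, Finset.mem_filter, Finset.mem_univ, true_and] at hx
      have : rep R x = 0 := by
        by_contra h
        exact hx (or_iff_not_imp_left.mpr fun h' => ⟨h', Nat.pos_of_ne_zero h⟩)
      rw [this]; rfl
    rw [Finset.sum_insert (by simp [hs])] at h2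
    omega
  have hub : ∑ x ∈ Q, rep R x ^ 2 ≤ Q.card * (2 * 2 ^ j) ^ 2 := by
    rw [← smul_eq_mul]
    refine Finset.sum_le_card_nsmul _ _ _ fun l hl => ?_
    have := (hQs l hl).2.2
    gcongr
    rw [← this, ← pow_succ']
    exact (Nat.lt_pow_succ_log_self (by norm_num) _).le
  have hnrg : nrg R ≤ 8 * L * ((2 ^ j) ^ 2 * Q.card) := by
    have h1 : ∑ x ∈ s, rep R x ^ 2 ≤ L * (Q.card * (2 * 2 ^ j) ^ 2) := hj.trans (Nat.mul_le_mul_left _ hub)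
    have h2 : L * (Q.card * (2 * 2 ^ j) ^ 2) = 4 * (L * ((2 ^ j) ^ 2 * Q.card)) := by ring
    have h3 : 8 * L * ((2 ^ j) ^ 2 * Q.card) = 8 * (L * ((2 ^ j) ^ 2 * Q.card)) := by ring
    omega
  have hQne : Q.Nonempty := by
    rw [Finset.nonempty_iff_ne_empty]
    intro h
    rw [h] at hnrg
    simp at hnrg
    rw [hnrg] at hE
    have : 0 < t ^ 2 := by positivity
    omega
  refine ⟨2 ^ j, Q, by positivity, ?_, fun x hx => (hQs x hx).1, ?_, hlow, ?_, hnrg⟩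
  · obtain ⟨x, hx⟩ := hQne
    rw [← hcard]
    exact (hlow x hx).trans (rep_le_card R x)
  · intro x hx a ha
    obtain ⟨h1, h2, h3⟩ := hQs x hx
    simp only [hQ, hs, Finset.mem_filter, Finset.mem_univ, true_and]
    rw [rep_smul_eq hR ht x a ha]
    exact ⟨⟨mul_ne_zero (ne_zero_of_mem hR ht ha) h1, h2⟩, h3⟩
  · calc 2 ^ j * Q.card ≤ ∑ x ∈ Q, rep R x := by
          rw [mul_comm, ← smul_eq_mul]
          exact Finset.card_nsmul_le_sum _ _ _ hlow
      _ ≤ ∑ x, rep R x := Finset.sum_le_sum_of_subset (Finset.subset_univ _)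
      _ = t ^ 2 := by rw [sum_rep, hcard]

end comb2
end SixR

namespace SixR

section fourier
variable {p : ℕ} [Fact p.Prime]

/-- exponential sum -/
noncomputable def ft {ι : Type*} (I : Finset ι) (φ : ι → ZMod p) (ξ : ZMod p) : ℂ :=
  ∑ i ∈ I, ZMod.stdAddChar (φ i * ξ)

lemma ft_mul {ι κ : Type*} (I : Finset ι) (J : Finset κ) (φ : ι → ZMod p) (ψ : κ → ZMod p) (ξ : ZMod p) :
    ft I φ ξ * ft J ψ ξ = ft (I ×ˢ J) (fun q => φ q.1 + ψ q.2) ξ := by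
  unfold ft
  rw [Finset.sum_mul_sum, Finset.sum_product]
  refine Finset.sum_congr rfl fun i _ => Finset.sum_congr rfl fun j _ => ?_
  rw [add_mul, AddChar.map_add_eq_mul]

lemma sum_ft {ι : Type*} (I : Finset ι) (φ : ι → ZMod p) :
    ∑ ξ : ZMod p, ft I φ ξ = (p : ℂ) * (#{i ∈ I | φ i = 0} : ℂ) := by
  unfold ft
  rw [Finset.sum_comm]
  have : ∀ i ∈ I, ∑ ξ : ZMod p, ZMod.stdAddChar (φ i * ξ) = if φ i = 0 then (p : ℂ) else 0 := by
    intro i _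
    have := AddChar.sum_mulShift (φ i) (ZMod.isPrimitive_stdAddChar p)
    simp only [mul_comm _ (φ i), ZMod.card] at this
    rw [this]
    split_ifs <;> simp
  rw [Finset.sum_congr rfl this, ← Finset.sum_filter, Finset.sum_const, nsmul_eq_mul, mul_comm]

lemma conj_ft {ι : Type*} (I : Finset ι) (φ : ι → ZMod p) (ξ : ZMod p) :
    (starRingEnd ℂ) (ft I φ ξ) = ft I (fun i => - φ i) ξ := by
  unfold ft
  rw [map_sum]
  refine Finset.sum_congr rfl fun i _ => ?_
  rw [neg_mul, AddChar.map_neg_eq_conj]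

lemma norm_sq_ft {ι : Type*} (I : Finset ι) (φ : ι → ZMod p) (ξ : ZMod p) :
    ((‖ft I φ ξ‖ ^ 2 : ℝ) : ℂ) = ft (I ×ˢ I) (fun q => φ q.1 - φ q.2) ξ := by
  have := Complex.mul_conj' (ft I φ ξ)
  push_cast
  rw [← this, conj_ft, ft_mul]
  simp only [sub_eq_add_neg]

lemma norm_ft_sub {ι : Type*} (I : Finset ι) (φ : ι → ZMod p) (ξ : ZMod p) :
    ‖ft (I ×ˢ I) (fun q => φ q.1 - φ q.2) ξ‖ = ‖ft I φ ξ‖ ^ 2 := by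
  rw [← norm_sq_ft, Complex.norm_real]
  simp

lemma plancherel {ι : Type*} (I : Finset ι) (φ : ι → ZMod p) :
    ∑ ξ : ZMod p, ‖ft I φ ξ‖ ^ 2 = (p : ℝ) * (#{q ∈ I ×ˢ I | φ q.1 = φ q.2} : ℝ) := by
  have h : ((∑ ξ : ZMod p, ‖ft I φ ξ‖ ^ 2 : ℝ) : ℂ) = (p : ℂ) * (#{q ∈ I ×ˢ I | φ q.1 = φ q.2} : ℂ) := by
    rw [Complex.ofReal_sum, Finset.sum_congr rfl (fun ξ _ => norm_sq_ft I φ ξ), sum_ft]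
    simp only [sub_eq_zero]
  exact_mod_cast h

lemma plancherel_id (A : Finset (ZMod p)) :
    ∑ ξ : ZMod p, ‖ft A id ξ‖ ^ 2 = (p : ℝ) * (A.card : ℝ) := by
  rw [plancherel]
  congr 2
  have : {q ∈ A ×ˢ A | id q.1 = id q.2} = A.diag := by
    ext ⟨a, b⟩
    simp only [Finset.mem_filter, Finset.mem_product, Finset.mem_diag, id]
    constructor
    · rintro ⟨⟨h1, h2⟩, h3⟩; exact ⟨h1, h3⟩
    · rintro ⟨h1, h3⟩; exact ⟨⟨h1, h3 ▸ h1⟩, h3⟩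
  rw [this, Finset.diag_card]

lemma fourth_moment (R : Finset (ZMod p)) :
    ∑ ξ : ZMod p, ‖ft R id ξ‖ ^ 4 = (p : ℝ) * (nrg R : ℝ) := by
  have : ∀ ξ : ZMod p, ‖ft R id ξ‖ ^ 4 = ‖ft (R ×ˢ R) (fun q => id q.1 - id q.2) ξ‖ ^ 2 := by
    intro ξ; rw [norm_ft_sub, ← pow_mul]
  rw [Finset.sum_congr rfl (fun ξ _ => this ξ), plancherel, nrg_eq]
  rfl

variable {R : Finset (ZMod p)} {t : ℕ}

lemma ft_smul (hR : ∀ x, x ∈ R ↔ x ^ t = 1) (ht : 0 < t) (c ξ : ZMod p) (hc : c ∈ R) :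
    ft R id (c * ξ) = ft R id ξ := by
  unfold ft
  have hc0 := ne_zero_of_mem hR ht hc
  refine Finset.sum_bij' (fun a _ => a * c) (fun a _ => a * c⁻¹) ?_ ?_ ?_ ?_ ?_
  · intro a ha; exact mul_mem' hR ha hc
  · intro a ha; exact mul_mem' hR ha (inv_mem' hR hc)
  · intro a _; field_simp
  · intro a _; field_simp
  · intro a _; simp only [id]; rw [mul_assoc]

lemma sum_dilate (ξ : ZMod p) (hξ : ξ ≠ 0) (f : ZMod p → ℝ) : ∑ x, f (x * ξ) = ∑ x, f x :=
  Fintype.sum_bijective (fun x => x * ξ) (mulRight_bijective₀ ξ hξ) _ _ (fun _ => rfl)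

lemma sum_pairs (f : ZMod p → ℝ) :
    ∑ q ∈ R ×ˢ R, f (q.1 - q.2) = ∑ x, (rep R x : ℝ) * f x := by
  rw [← Finset.sum_fiberwise_of_maps_to (s := R ×ˢ R) (t := univ) (g := fun q => q.1 - q.2) (by simp)]
  refine Finset.sum_congr rfl fun x _ => ?_
  rw [Finset.sum_congr rfl (g := fun _ => f x) (by intro q hq; rw [(Finset.mem_filter.mp hq).2])]
  rw [Finset.sum_const, nsmul_eq_mul]; rfl

lemma ft_bound (hR : ∀ x, x ∈ R ↔ x ^ t = 1) (hcard : R.card = t) (ht : 0 < t) (ξ : ZMod p) (hξ : ξ ≠ 0) :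
    ‖ft R id ξ‖ ^ 8 ≤ (p : ℝ) * (nrg R : ℝ) ^ 2 ∧ ‖ft R id ξ‖ ^ 2 ≤ p := by
  have htr : (0 : ℝ) < t := by exact_mod_cast ht
  set ρ := ‖ft R id ξ‖ with hρ
  have h1 : (t : ℝ) * ρ ^ 2 ≤ ∑ q ∈ R ×ˢ R, ‖ft R id ((q.1 - q.2) * ξ)‖ := by
    have e1 : ∑ c ∈ R, ft (R ×ˢ R) (fun q => id q.1 - id q.2) (c * ξ) = (t : ℂ) * ((ρ ^ 2 : ℝ) : ℂ) := by
      rw [← hcard, ← nsmul_eq_mul, ← Finset.sum_const]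
      refine Finset.sum_congr rfl fun c hc => ?_
      rw [← norm_sq_ft, ft_smul hR ht c ξ hc]
    have e2 : ∑ c ∈ R, ft (R ×ˢ R) (fun q => id q.1 - id q.2) (c * ξ)
        = ∑ q ∈ R ×ˢ R, ft R id ((q.1 - q.2) * ξ) := by
      unfold ft
      rw [Finset.sum_comm]
      refine Finset.sum_congr rfl fun q _ => Finset.sum_congr rfl fun c _ => ?_
      simp only [id]
      congr 1; ring
    have e3 : (t : ℝ) * ρ ^ 2 = ‖∑ q ∈ R ×ˢ R, ft R id ((q.1 - q.2) * ξ)‖ := by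
      rw [← e2, e1, norm_mul, Complex.norm_real]
      simp
    rw [e3]
    exact norm_sum_le _ _
  have h2 : ρ ^ 4 ≤ ∑ x, (rep R x : ℝ) * ‖ft R id (x * ξ)‖ ^ 2 := by
    rw [← sum_pairs (fun x => ‖ft R id (x * ξ)‖ ^ 2)]
    have hc := sq_sum_le_card_mul_sum_sq (s := R ×ˢ R) (f := fun q => ‖ft R id ((q.1 - q.2) * ξ)‖)
    rw [Finset.card_product, hcard] at hc
    push_cast at hc
    have h3 : ((t : ℝ) * ρ ^ 2) ^ 2 ≤ (∑ q ∈ R ×ˢ R, ‖ft R id ((q.1 - q.2) * ξ)‖) ^ 2 := by gcongr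
    refine le_of_mul_le_mul_left (a := (t : ℝ) * t) ?_ (by positivity)
    calc (t : ℝ) * t * ρ ^ 4 = ((t : ℝ) * ρ ^ 2) ^ 2 := by ring
      _ ≤ _ := h3.trans hc
  constructor
  · have hc := Finset.sum_mul_sq_le_sq_mul_sq univ (fun x : ZMod p => (rep R x : ℝ)) (fun x => ‖ft R id (x * ξ)‖ ^ 2)
    have e : ∑ x : ZMod p, (‖ft R id (x * ξ)‖ ^ 2) ^ 2 = (p : ℝ) * nrg R := by
      rw [← fourth_moment, ← sum_dilate ξ hξ (fun x => ‖ft R id x‖ ^ 4)]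
      refine Finset.sum_congr rfl fun x _ => ?_
      ring
    have e' : ∑ x : ZMod p, (rep R x : ℝ) ^ 2 = nrg R := by
      unfold nrg; push_cast; rfl
    rw [e, e'] at hc
    calc ρ ^ 8 = (ρ ^ 4) ^ 2 := by ring
      _ ≤ (∑ x, (rep R x : ℝ) * ‖ft R id (x * ξ)‖ ^ 2) ^ 2 := by gcongr
      _ ≤ _ := hc
      _ = _ := by ring
  · have h3 : (t : ℝ) * ρ ^ 2 ≤ (p : ℝ) * t := by
      rw [← hcard, ← plancherel_id, ← sum_dilate ξ hξ (fun x => ‖ft R id x‖ ^ 2), ← nsmul_eq_mul, ← Finset.sum_const]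
      rw [Finset.sum_congr rfl (g := fun x => ‖ft R id (x * ξ)‖ ^ 2)
        (by intro c hc; rw [ft_smul hR ht c ξ hc])]
      exact Finset.sum_le_sum_of_subset_of_nonneg (Finset.subset_univ _) (fun _ _ _ => by positivity)
    nlinarith

lemma fourier_main (hR : ∀ x, x ∈ R ↔ x ^ t = 1) (hcard : R.card = t) (ht : 0 < t) (l : ZMod p) (hl : l ≠ 0)
    (hno : ∀ a ∈ R, ∀ b ∈ R, ∀ c ∈ R, ∀ d ∈ R, ∀ e ∈ R, ∀ f ∈ R, a + b + (c + d) + e + f ≠ l) :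
    ((R + R).card * t ^ 3) ^ 8 ≤ p ^ 11 * nrg R ^ 6 ∧ ((R + R).card * t ^ 3) ^ 2 ≤ p ^ 5 := by
  have hne : ((univ : Finset (ZMod p)).erase 0).Nonempty := ⟨1, by simp⟩
  obtain ⟨ξ, hξ, hmax⟩ := Finset.exists_max_image _ (fun ξ => ‖ft R id ξ‖) hne
  have hξ0 : ξ ≠ 0 := (Finset.mem_erase.mp hξ).1
  obtain ⟨hb1, hb2⟩ := ft_bound hR hcard ht ξ hξ0
  set ρ := ‖ft R id ξ‖ with hρ
  have hρ0 : 0 ≤ ρ := norm_nonneg _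
  have hmax' : ∀ η : ZMod p, η ≠ 0 → ‖ft R id η‖ ≤ ρ := fun η hη => hmax η (by simp [hη])
  set S := R + R with hS
  have hSpos : 0 < S.card := by
    refine Finset.card_pos.mpr ⟨1 + 1, Finset.add_mem_add (one_mem hR) (one_mem hR)⟩
  have hsum : ∑ η : ZMod p, ft S id η * ft S id η * ft R id η * ft R id η * ft R id (-l * η) = 0 := by
    have e : ∀ η : ZMod p, ft R id (-l * η) = ft R (fun c => c * (-l)) η := by
      intro η; unfold ft
      refine Finset.sum_congr rfl fun c _ => ?_
      simp only [id]; rw [mul_assoc]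
    simp only [e, ft_mul]
    rw [sum_ft]
    rw [Finset.filter_eq_empty_iff.mpr]
    · simp
    · rintro ⟨⟨⟨⟨s1, s2⟩, r1⟩, r2⟩, c⟩ hq
      simp only [Finset.mem_product] at hq
      obtain ⟨⟨⟨⟨h1, h2⟩, h3⟩, h4⟩, h5⟩ := hq
      obtain ⟨a, ha, b, hb, rfl⟩ := Finset.mem_add.mp h1
      obtain ⟨a', ha', b', hb', rfl⟩ := Finset.mem_add.mp h2
      simp only [id]
      intro h
      have hc0 := ne_zero_of_mem hR ht h5
      have hi := inv_mem' hR h5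
      refine hno _ (mul_mem' hR hi ha) _ (mul_mem' hR hi hb) _ (mul_mem' hR hi ha') _ (mul_mem' hR hi hb')
        _ (mul_mem' hR hi h3) _ (mul_mem' hR hi h4) ?_
      field_simp
      linear_combination h
  have h0 : ∀ A : Finset (ZMod p), ft A id 0 = (A.card : ℂ) := by
    intro A; unfold ft; simp
  rw [← Finset.add_sum_erase _ _ (Finset.mem_univ 0)] at hsum
  rw [mul_zero, h0, h0, hcard] at hsum
  have hb : (S.card : ℝ) ^ 2 * t ^ 3 ≤ ρ ^ 3 * (p * S.card) := by
    have e1 : (S.card : ℝ) ^ 2 * t ^ 3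
        = ‖∑ η ∈ univ.erase 0, ft S id η * ft S id η * ft R id η * ft R id η * ft R id (-l * η)‖ := by
      rw [← norm_neg, ← eq_neg_of_add_eq_zero_left hsum]
      simp only [norm_mul, Complex.norm_natCast]
      ring
    rw [e1, ← plancherel_id, Finset.mul_sum]
    refine (norm_sum_le _ _).trans ?_
    refine le_trans (Finset.sum_le_sum (g := fun η => ρ ^ 3 * ‖ft S id η‖ ^ 2) ?_)
      (Finset.sum_le_sum_of_subset_of_nonneg (Finset.subset_univ _) (fun _ _ _ => by positivity))
    intro η hη
    have hη0 := (Finset.mem_erase.mp hη).1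
    simp only [norm_mul]
    have i1 := hmax' η hη0
    have i2 := hmax' (-l * η) (mul_ne_zero (neg_ne_zero.mpr hl) hη0)
    calc ‖ft S id η‖ * ‖ft S id η‖ * ‖ft R id η‖ * ‖ft R id η‖ * ‖ft R id (-l * η)‖
        ≤ ‖ft S id η‖ * ‖ft S id η‖ * ρ * ρ * ρ := by gcongr
      _ = _ := by ring
  have hSr : (0 : ℝ) < S.card := by exact_mod_cast hSpos
  have hb' : (S.card : ℝ) * t ^ 3 ≤ ρ ^ 3 * p := by
    refine le_of_mul_le_mul_left (a := (S.card : ℝ)) ?_ hSr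
    calc (S.card : ℝ) * (S.card * t ^ 3) = (S.card : ℝ) ^ 2 * t ^ 3 := by ring
      _ ≤ _ := hb
      _ = _ := by ring
  constructor
  · have : ((S.card : ℝ) * t ^ 3) ^ 8 ≤ (p : ℝ) ^ 11 * (nrg R : ℝ) ^ 6 := by
      calc ((S.card : ℝ) * t ^ 3) ^ 8 ≤ (ρ ^ 3 * p) ^ 8 := by gcongr
        _ = (ρ ^ 8) ^ 3 * p ^ 8 := by ring
        _ ≤ ((p : ℝ) * (nrg R : ℝ) ^ 2) ^ 3 * p ^ 8 := by gcongr
        _ = _ := by ring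
    exact_mod_cast this
  · have : ((S.card : ℝ) * t ^ 3) ^ 2 ≤ (p : ℝ) ^ 5 := by
      calc ((S.card : ℝ) * t ^ 3) ^ 2 ≤ (ρ ^ 3 * p) ^ 2 := by gcongr
        _ = (ρ ^ 2) ^ 3 * p ^ 2 := by ring
        _ ≤ (p : ℝ) ^ 3 * p ^ 2 := by gcongr
        _ = _ := by ring
    exact_mod_cast this

end fourier
end SixR

namespace SixR

lemma llog {a b : ℕ} (ha : 0 < a) (h : a ≤ b) : Real.log (a : ℝ) ≤ Real.log (b : ℝ) :=
  Real.log_le_log (by exact_mod_cast ha) (by exact_mod_cast h)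

lemma llog_inv {a b : ℕ} (hb : 0 < b) (h : Real.log (a : ℝ) ≤ Real.log (b : ℝ)) : a ≤ b := by
  rcases Nat.eq_zero_or_pos a with ha | ha
  · omega
  · have := (Real.log_le_log_iff (by exact_mod_cast ha) (by exact_mod_cast hb)).mp h
    exact_mod_cast this

/-- existence of the threshold -/
lemma exists_threshold : ∃ p₀ : ℕ, 2 ≤ p₀ ∧ ∀ p : ℕ, p₀ ≤ p →
    100000 * (Real.log 2 + Real.log ((Nat.log 2 p + 1 : ℕ) : ℝ)) ≤ Real.log p := by
  have h1 := (Real.isLittleO_log_id_atTop.bound (c := 1 / 1000000) (by norm_num))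
  have h2 := Filter.eventually_ge_atTop (10000000 : ℝ)
  have h3 : Filter.Tendsto (fun n : ℕ => Real.log (n : ℝ)) Filter.atTop Filter.atTop :=
    Real.tendsto_log_atTop.comp tendsto_natCast_atTop_atTop
  obtain ⟨n, hn⟩ := Filter.eventually_atTop.mp (h3.eventually (h1.and h2))
  refine ⟨n + 2, by omega, fun p hp => ?_⟩
  obtain ⟨i1, i2⟩ := hn p (by omega)
  set y := Real.log (p : ℝ) with hy
  have hy0 : 0 < y := by linarith
  simp only [id, Real.norm_eq_abs, abs_of_pos hy0] at i1
  have i3 : Real.log y ≤ 1 / 1000000 * y := (le_abs_self _).trans i1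
  have l2 : (0.69 : ℝ) < Real.log 2 := by linarith [Real.log_two_gt_d9]
  have l2' : Real.log 2 < (0.7 : ℝ) := by linarith [Real.log_two_lt_d9]
  have hL : ((Nat.log 2 p + 1 : ℕ) : ℝ) ≤ 4 * y := by
    have h4 : Real.log ((2 ^ Nat.log 2 p : ℕ) : ℝ) ≤ y :=
      llog (by positivity) (Nat.pow_log_le_self 2 (by omega))
    push_cast at h4 ⊢
    rw [Real.log_pow] at h4
    have : (0 : ℝ) ≤ (Nat.log 2 p : ℝ) := by positivity
    nlinarith
  have h5 : Real.log ((Nat.log 2 p + 1 : ℕ) : ℝ) ≤ Real.log (4 * y) :=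
    Real.log_le_log (by positivity) hL
  have h6 : Real.log (4 * y) = 2 * Real.log 2 + Real.log y := by
    rw [Real.log_mul (by norm_num) hy0.ne', show (4 : ℝ) = 2 ^ 2 by norm_num, Real.log_pow]
    norm_num
  linarith

section final
variable {p : ℕ} [Fact p.Prime]
variable {R : Finset (ZMod p)} {t : ℕ}

set_option maxHeartbeats 4000000 in
lemma main_contra (hR : ∀ x, x ∈ R ↔ x ^ t = 1) (hcard : R.card = t) (hp2 : 2 ≤ p)
    (hth : 100000 * (Real.log 2 + Real.log ((Nat.log 2 p + 1 : ℕ) : ℝ)) ≤ Real.log p)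
    (htp : p ^ 41 ≤ t ^ 83) (l : ZMod p) (hl : l ≠ 0)
    (hno : ∀ a ∈ R, ∀ b ∈ R, ∀ c ∈ R, ∀ d ∈ R, ∀ e ∈ R, ∀ f ∈ R, a + b + (c + d) + e + f ≠ l) : False := by
  have htpos : 0 < t := by
    rcases Nat.eq_zero_or_pos t with h | h
    · rw [h] at htp
      have : 0 < p ^ 41 := by positivity
      simp at htp; omega
    · exact h
  have htlep : t ≤ p := by
    rw [← hcard]
    have := Finset.card_le_univ R
    rwa [ZMod.card] at this
  obtain ⟨f1, f2⟩ := fourier_main hR hcard htpos l hl hno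
  have f3 := cauchy_nrg R
  rw [hcard] at f3
  have hSt : t ≤ (R + R).card := by
    rw [← hcard]; exact Finset.card_le_card_add_right ⟨1, one_mem hR⟩
  have hex := exists_level hR hcard htpos
  have hlev := rep_level hR hcard
  have hkk := katz_koester hR hcard
  set S := (R + R).card with hS
  set E := nrg R with hE
  have hSpos : 0 < S := by omega
  have hEpos : 0 < E := by
    rcases Nat.eq_zero_or_pos E with h | h
    · rw [h] at f3
      have : 0 < t ^ 4 := by positivity
      omega
    · exact h
  set L := Nat.log 2 t + 1 with hLdef
  have hLt : t < 2 ^ L := Nat.lt_pow_succ_log_self (by norm_num) t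
  have hLpos : 0 < L := by omega
  have hLp : L ≤ Nat.log 2 p + 1 := by
    rw [hLdef]; gcongr
  set H := 65 + 32 * t ^ 2 / p with hH
  have hH64 : 64 ≤ H := le_trans (by norm_num) (Nat.le_add_right 65 _)
  have hppos : 0 < p := by omega
  have hH2 : 32 * t ^ 2 ≤ p * H := by
    have := Nat.lt_mul_div_succ (32 * t ^ 2) hppos
    calc 32 * t ^ 2 ≤ p * (32 * t ^ 2 / p + 1) := this.le
      _ ≤ p * H := by rw [hH, add_comm]; gcongr; norm_num
  have np : (p : ℝ) ≠ 0 := by exact_mod_cast hppos.ne'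
  have nt : (t : ℝ) ≠ 0 := by exact_mod_cast htpos.ne'
  have nS : (S : ℝ) ≠ 0 := by exact_mod_cast hSpos.ne'
  have nE : (E : ℝ) ≠ 0 := by exact_mod_cast hEpos.ne'
  have nL : (L : ℝ) ≠ 0 := by exact_mod_cast hLpos.ne'
  have nH : (H : ℝ) ≠ 0 := by
    have : H ≠ 0 := by omega
    exact_mod_cast this
  have n2 : (2 : ℝ) ≠ 0 := two_ne_zero
  have hlg : ∀ k : ℕ, Real.log ((2 : ℝ) ^ k) = k * Real.log 2 := fun k => Real.log_pow _ _
  have lg4 : Real.log 4 = 2 * Real.log 2 := by have := hlg 2; norm_num at this; exact this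
  have lg8 : Real.log 8 = 3 * Real.log 2 := by have := hlg 3; norm_num at this; exact this
  have lg32 : Real.log 32 = 5 * Real.log 2 := by have := hlg 5; norm_num at this; exact this
  have lg128 : Real.log 128 = 7 * Real.log 2 := by have := hlg 7; norm_num at this; exact this
  have lg12 : Real.log 4096 = 12 * Real.log 2 := by have := hlg 12; norm_num at this; exact this
  have lg42 : Real.log 4398046511104 = 42 * Real.log 2 := by have := hlg 42; norm_num at this; exact this
  have c0 : 0 < Real.log 2 := Real.log_pos (by norm_num)
  have l0 : 0 ≤ Real.log (L : ℝ) := Real.log_nonneg (by exact_mod_cast hLpos)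
  have g6 : 100000 * (Real.log 2 + Real.log (L : ℝ)) ≤ Real.log p := by
    have := llog hLpos hLp
    linarith
  have P0 : 0 < Real.log (p : ℝ) := by linarith
  have g1 := llog (by positivity) htp
  have g2 := llog (by positivity) f1
  have g3 := llog (by positivity) f2
  have g4 := llog (by positivity) f3
  have g5 := llog (by positivity) hSt
  have g7 := llog (by positivity) htlep
  push_cast at g1 g2 g3 g4
  simp (discharger := positivity) only [Real.log_mul, Real.log_pow] at g1 g2 g3 g4
  push_cast at g1 g2 g3 g4
  have gH : Real.log (H : ℝ) ≤ 7 * Real.log 2 ∨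
      Real.log (H : ℝ) ≤ 7 * Real.log 2 + (2 * Real.log t - Real.log p) ∧ Real.log (p : ℝ) ≤ 2 * Real.log t := by
    rcases le_total (t ^ 2) p with h | h
    · left
      have : H ≤ 2 ^ 7 := by
        have : 32 * t ^ 2 / p ≤ 32 := by
          apply Nat.div_le_of_le_mul
          nlinarith
        omega
      have := llog (by omega) this
      push_cast at this
      linarith
    · right
      have h1 : p * H ≤ 2 ^ 7 * t ^ 2 := by
        have := Nat.mul_div_le (32 * t ^ 2) p
        rw [hH, mul_add]
        nlinarith
      have h2 := llog (by positivity) h1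
      have h3 := llog (by positivity) h
      push_cast at h2 h3
      simp (discharger := positivity) only [Real.log_mul, Real.log_pow] at h2 h3
      push_cast at h2 h3
      constructor <;> linarith
  clear_value H S E L
  generalize hP : Real.log (p : ℝ) = P at *
  generalize hT : Real.log (t : ℝ) = T at *
  generalize hs : Real.log (S : ℝ) = s at *
  generalize he : Real.log (E : ℝ) = e at *
  generalize hll : Real.log (L : ℝ) = ll at *
  generalize hhh : Real.log (H : ℝ) = h at *
  generalize hcc : Real.log (2 : ℝ) = c at *
  -- case of large subgroups
  have hTP : 3 * T ≤ 2 * P := by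
    by_contra hcon
    push Not at hcon
    linarith
  have ht6 : 6 ≤ t := by
    have : 8 ≤ t := llog_inv htpos (by push_cast; rw [lg8, hT]; linarith)
    omega
  have htp3 : 4 * t ^ 4 ≤ p ^ 3 := by
    apply llog_inv (by positivity)
    push_cast
    simp (discharger := positivity) only [Real.log_mul, Real.log_pow]
    rw [lg4, hT, hP]; push_cast; linarith
  have hE2 : 2 * t ^ 2 ≤ E := by
    apply llog_inv hEpos
    push_cast
    simp (discharger := positivity) only [Real.log_mul, Real.log_pow]
    rw [hcc, hT, he]; push_cast
    by_contra hcon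
    push Not at hcon
    linarith
  obtain ⟨τ, Q, hτ0, hτt, hQ0, hQinv, hQτ, hτQ, hEQ⟩ := hex L hLt hE2
  have hQpos : 0 < Q.card := by
    rcases Nat.eq_zero_or_pos Q.card with h' | h'
    · rw [h'] at hEQ; simp at hEQ; omega
    · exact h'
  have hlev' := hlev τ Q hQ0 hQτ
  have hkk' := hkk H L τ Q hQ0 hQinv hQτ
  generalize Q.card = q at *
  have nτ : (τ : ℝ) ≠ 0 := by exact_mod_cast hτ0.ne'
  have nq : (q : ℝ) ≠ 0 := by exact_mod_cast hQpos.ne'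
  have k1 := llog hτ0 hτt
  have k2 := llog (by positivity) hτQ
  have k3 := llog hEpos hEQ
  push_cast at k2 k3
  simp (discharger := positivity) only [Real.log_mul, Real.log_pow] at k2 k3
  push_cast at k2 k3
  rw [lg8, he, hll] at k3
  rw [hT] at k1 k2
  generalize hu : Real.log (τ : ℝ) = u at *
  generalize hw : Real.log (q : ℝ) = w at *
  have hlev2 : H ≤ τ → 3 * u + w ≤ 12 * c + 3 * T := by
    intro hHτ
    have := llog (by positivity) (hlev' (hH64.trans hHτ) (hH2.trans (Nat.mul_le_mul_left _ hHτ)) ht6 htp3)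
    push_cast at this
    simp (discharger := positivity) only [Real.log_mul, Real.log_pow] at this
    rw [lg12, hT, hu, hw] at this
    push_cast at this
    linarith
  have k4 : 2 * (2 * u + w) ≤ 14 * c + 5 * T := by
    by_cases hHτ : H ≤ τ
    · have := hlev2 hHτ
      linarith
    · have := llog hτ0 (le_of_not_ge hHτ)
      rw [hu, hhh] at this
      rcases gH with gH | gH <;> linarith
  have k5 : 8 * s + 9 * T ≤ 11 * P + 60 * c + 6 * ll := by linarith
  have k6 : 2 * T - s - 3 * c - ll ≤ u := by linarith
  have hHτ : H ≤ τ := by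
    apply llog_inv hτ0
    rw [hhh, hu]
    rcases gH with gH | gH <;> linarith
  have k7 := hlev2 hHτ
  have k8 : w ≤ s + 3 * c + ll := by linarith
  have q1 : 4 * t ≤ τ * q := by
    apply llog_inv (by positivity)
    push_cast
    simp (discharger := positivity) only [Real.log_mul, Real.log_pow]
    rw [lg4, hT, hu, hw]; linarith
  have q2 : 32 * S ^ 2 * q ≤ t ^ 5 := by
    apply llog_inv (by positivity)
    push_cast
    simp (discharger := positivity) only [Real.log_mul, Real.log_pow]
    rw [lg32, hT, hs, hw]; push_cast; linarith
  have q3 : 4 * t * S ^ 2 * q ≤ p ^ 3 := by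
    apply llog_inv (by positivity)
    push_cast
    simp (discharger := positivity) only [Real.log_mul, Real.log_pow]
    rw [lg4, hT, hs, hw, hP]; push_cast; linarith
  have k9 := llog (by positivity) (hkk' q1 q2 q3 hLt hH64 hH2 ht6 htp3)
  push_cast at k9
  simp (discharger := positivity) only [Real.log_mul, Real.log_pow] at k9
  rw [lg42, hT, hs, hw, hu, hhh, hll] at k9
  push_cast at k9
  have k10 : 6 * e ≤ 84 * c + 12 * ll + 3 * h + 8 * T + 4 * s := by linarith
  have k11 : 112 * T ≤ 55 * P + 21 * h + 1000 * c + 1000 * ll := by linarith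
  rcases gH with gH | gH <;> linarith

end final
end SixR

namespace SixR

lemma mem_iff_pow {p : ℕ} [Fact p.Prime] (R : Finset (ZMod p)) (hR : IsMulSubgroup p R) :
    ∀ x, x ∈ R ↔ x ^ R.card = 1 := by
  obtain ⟨H, hH⟩ := hR
  have hmem : ∀ x, x ∈ R ↔ ∃ u ∈ H, (u : ZMod p) = x := by
    intro x
    rw [← Finset.mem_coe, hH]
    simp
  have hcard : R.card = Nat.card H := by
    rw [← Set.ncard_coe_finset, hH, Set.ncard_image_of_injective _ Units.val_injective]
    rfl
  have hpos : 0 < R.card := Finset.card_pos.mpr ⟨1, (hmem 1).mpr ⟨1, H.one_mem, rfl⟩⟩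
  have hsub : R ⊆ (Polynomial.nthRoots R.card (1 : ZMod p)).toFinset := by
    intro x hx
    rw [Multiset.mem_toFinset, Polynomial.mem_nthRoots hpos]
    obtain ⟨u, hu, rfl⟩ := (hmem x).mp hx
    have h1 : (⟨u, hu⟩ : H) ^ Nat.card H = 1 := pow_card_eq_one'
    have h2 : u ^ Nat.card H = 1 := congrArg Subtype.val h1
    rw [hcard, ← Units.val_pow_eq_pow_val, h2, Units.val_one]
  have heq : R = (Polynomial.nthRoots R.card (1 : ZMod p)).toFinset := by
    refine Finset.eq_of_subset_of_card_le hsub ?_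
    exact (Multiset.toFinset_card_le _).trans (Polynomial.card_nthRoots _ _)
  intro x
  conv_lhs => rw [heq]
  rw [Multiset.mem_toFinset, Polynomial.mem_nthRoots hpos]

end SixR

theorem sixfold_sums_cover (κ : ℝ) (hκ : 41 / 83 < κ) :
    ∃ p₀ : ℕ, 0 < p₀ ∧ ∀ p : ℕ, p.Prime → p₀ ≤ p → ∀ R : Finset (ZMod p), IsMulSubgroup p R →
          (p : ℝ) ^ κ ≤ (R.card : ℝ) → ∀ x : ZMod p, x ≠ 0 →
            ∃ r : Fin 6 → ZMod p, (∀ i, r i ∈ R) ∧ ∑ i, r i = x := by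
  obtain ⟨p₀, hp₀, hth⟩ := SixR.exists_threshold
  refine ⟨p₀, by omega, ?_⟩
  intro p hp hpp R hR hcard x hx
  haveI : Fact p.Prime := ⟨hp⟩
  by_contra hno
  have hp1 : (1 : ℝ) ≤ p := by exact_mod_cast hp.one_le
  refine SixR.main_contra (SixR.mem_iff_pow R hR) rfl hp.two_le (hth p hpp) ?_ x hx ?_
  · have h1 : (p : ℝ) ^ ((41 : ℝ) / 83) ≤ (R.card : ℝ) :=
      (Real.rpow_le_rpow_of_exponent_le hp1 hκ.le).trans hcard
    have h2 : ((p : ℝ) ^ ((41 : ℝ) / 83)) ^ 83 ≤ (R.card : ℝ) ^ 83 := by gcongr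
    rw [← Real.rpow_mul_natCast (by positivity)] at h2
    norm_num at h2
    exact_mod_cast h2
  · intro a ha b hb c hc d hd e he f hf h
    apply hno
    refine ⟨![a, b, c, d, e, f], ?_, ?_⟩
    · intro i
      fin_cases i <;> simpa
    · rw [← h]
      simp [Fin.sum_univ_six]
      ring
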